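/- arXiv:1210.7566 — 5 statements merged into one kernel-verified Lean document; each statement's English description precedes it below -/
import Mathlib

section
/- Let n ≥ 1 be an integer and let p > 1, t₀ > 0 and κ be real numbers. Let γ = (γ⁰, γ¹, …, γⁿ) : [s₀, s₁] → ℝ^{1+n} be a C¹ curve with γ⁰(s₀) = t₀ and (γ⁰)'(s) ≥ 0 for all s, and suppose the causality condition e^{2κ}·(γ⁰(s)/t₀)^{2p}·Σ_{i=1}^{n}((γⁱ)'(s))² ≤ ((γ⁰)'(s))² holds for all s ∈ [s₀, s₁]. Then the projected spatial length satisfies ∫_{s₀}^{s₁} e^{κ}·(Σ_{i=1}^{n}((γⁱ)'(s))²)^{1/2} ds ≤ t₀/(p−1). -/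
/-- Derivative of the primitive of `(u / t₀) ^ (-p) * u'`. -/
theorem hasDerivWithinAt_rpow_primitive {p t₀ u' s : ℝ} {u : ℝ → ℝ} {S : Set ℝ} (hp : 1 < p)
    (ht₀ : 0 < t₀) (hu : 0 < u s) (h : HasDerivWithinAt u u' S s) :
    HasDerivWithinAt (fun s => -(t₀ / (p - 1)) * (u s / t₀) ^ (1 - p))
      ((u s / t₀) ^ (-p) * u') S s := by
  have hq : u s / t₀ ≠ 0 := (div_pos hu ht₀).ne'
  refine (((h.div_const t₀).rpow_const (p := 1 - p) (Or.inl hq)).const_mul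
    (-(t₀ / (p - 1)))).congr_deriv ?_
  have hp' : p - 1 ≠ 0 := (sub_pos.2 hp).ne'
  rw [show 1 - p - 1 = -p by ring]
  field_simp
  ring

/-- The causality condition bounds the spatial speed pointwise. -/
theorem exp_mul_sqrt_le_of_causal {p κ a v w : ℝ} (ha : 0 < a) (hv : 0 ≤ v)
    (h : Real.exp (2 * κ) * a ^ (2 * p) * w ≤ v ^ 2) :
    Real.exp κ * Real.sqrt w ≤ a ^ (-p) * v := by
  have hap : 0 < a ^ p := Real.rpow_pos_of_pos ha p
  have hsq : Real.exp (2 * κ) * a ^ (2 * p) = (Real.exp κ * a ^ p) ^ 2 := by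
    rw [mul_pow, ← Real.exp_nat_mul, ← Real.rpow_mul_natCast ha.le, mul_comm p]
    norm_num
  rw [Real.rpow_neg ha.le, inv_mul_eq_div, le_div_iff₀ hap]
  have hroot := Real.sqrt_le_sqrt h
  rw [hsq, Real.sqrt_mul (sq_nonneg _), Real.sqrt_sq (by positivity), Real.sqrt_sq hv] at hroot
  linarith

/-- A causal curve in the power-law inflationary spacetime starting at
time `t₀` has projected spatial length at most the characteristic length `t₀/(p−1)`. -/
theorem stmt_3 (n : ℕ) (hn : 1 ≤ n) (p t₀ κ s₀ s₁ : ℝ) (hp : 1 < p) (ht₀ : 0 < t₀)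
    (hs : s₀ ≤ s₁)
    (γ0 : ℝ → ℝ) (γ : Fin n → ℝ → ℝ) (dγ0 : ℝ → ℝ) (dγ : Fin n → ℝ → ℝ)
    (hd0 : ∀ s ∈ Set.Icc s₀ s₁, HasDerivWithinAt γ0 (dγ0 s) (Set.Icc s₀ s₁) s)
    (hd : ∀ i : Fin n, ∀ s ∈ Set.Icc s₀ s₁,
      HasDerivWithinAt (γ i) (dγ i s) (Set.Icc s₀ s₁) s)
    (hc0 : ContinuousOn dγ0 (Set.Icc s₀ s₁))
    (hc : ∀ i : Fin n, ContinuousOn (dγ i) (Set.Icc s₀ s₁))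
    (hinit : γ0 s₀ = t₀)
    (hmono : ∀ s ∈ Set.Icc s₀ s₁, 0 ≤ dγ0 s)
    (hcausal : ∀ s ∈ Set.Icc s₀ s₁,
      Real.exp (2 * κ) * (γ0 s / t₀) ^ (2 * p) * (∑ i, (dγ i s) ^ 2) ≤ (dγ0 s) ^ 2) :
    (∫ s in s₀..s₁, Real.exp κ * Real.sqrt (∑ i, (dγ i s) ^ 2)) ≤ t₀ / (p - 1) := by
  have hcont0 : ContinuousOn γ0 (Set.Icc s₀ s₁) := fun s h => (hd0 s h).continuousWithinAt
  have hγmono : MonotoneOn γ0 (Set.Icc s₀ s₁) :=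
    monotoneOn_of_hasDerivWithinAt_nonneg (convex_Icc s₀ s₁) hcont0
      (fun s h => (hd0 s (interior_subset h)).mono interior_subset)
      fun s h => hmono s (interior_subset h)
  have hpos : ∀ s ∈ Set.Icc s₀ s₁, 0 < γ0 s := fun s h =>
    ht₀.trans_le (hinit ▸ hγmono (Set.left_mem_Icc.2 hs) h h.1)
  have hprim : ∀ s ∈ Set.Icc s₀ s₁, HasDerivWithinAt _ _ (Set.Icc s₀ s₁) s := fun s h =>
    hasDerivWithinAt_rpow_primitive hp ht₀ (hpos s h) (hd0 s h)
  have hint : ContinuousOn (fun s => Real.exp κ * Real.sqrt (∑ i, (dγ i s) ^ 2))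
      (Set.Icc s₀ s₁) :=
    continuousOn_const.mul
      (continuousOn_finsetSum _ fun i _ => (hc i).pow 2).sqrt
  have hle := intervalIntegral.integral_le_sub_of_hasDeriv_right_of_le hs
    (fun s h => (hprim s h).continuousWithinAt)
    (fun s h => ((hprim s (Set.Ioo_subset_Icc_self h)).hasDerivAt
      (Icc_mem_nhds h.1 h.2)).hasDerivWithinAt)
    hint.integrableOn_Icc
    fun s h => exp_mul_sqrt_le_of_causal (div_pos (hpos s (Set.Ioo_subset_Icc_self h)) ht₀)
      (hmono s (Set.Ioo_subset_Icc_self h)) (hcausal s (Set.Ioo_subset_Icc_self h))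
  rw [hinit, div_self ht₀.ne', Real.one_rpow] at hle
  have hend : 0 ≤ t₀ / (p - 1) * (γ0 s₁ / t₀) ^ (1 - p) :=
    mul_nonneg (div_nonneg ht₀.le (sub_pos.2 hp).le)
      (Real.rpow_nonneg (div_pos (hpos s₁ (Set.right_mem_Icc.2 hs)) ht₀).le _)
  linarith
end

section
/- Let n ≥ 1 be an integer and let η ∈ (0, 1). Let g be a real symmetric (n+1)×(n+1) matrix with rows and columns indexed by 0, 1, …, n, whose spatial block G = (g_{ij})_{1≤i,j≤n} is positive definite, and which satisfies |1 + g₀₀| ≤ η and vᵀG⁻¹v ≤ η, where v = (g₀₁, …, g₀ₙ) ∈ ℝⁿ. Then every vector X = (X⁰, X♭) ∈ ℝ × ℝⁿ satisfying the causality condition Σ_{μ,ν=0}^{n} g_{μν}X^μX^ν ≤ 0 obeys X♭ᵀ G X♭ ≤ ((1 + η^{1/2} + η)/(1 − η^{1/2}))·(X⁰)². -/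
open Matrix
/-- Expansion of the quadratic form of `G` at `x + t G⁻¹ v`, for `G` positive definite. -/
theorem Matrix.PosDef.quadratic_shift_nonneg {ι : Type*} [Fintype ι] [DecidableEq ι]
    {G : Matrix ι ι ℝ} (hG : G.PosDef) (v x : ι → ℝ) (t : ℝ) :
    0 ≤ x ⬝ᵥ G *ᵥ x + 2 * t * (v ⬝ᵥ x) + t ^ 2 * (v ⬝ᵥ G⁻¹ *ᵥ v) := by
  have h := hG.posSemidef.dotProduct_mulVec_nonneg (x + t • G⁻¹ *ᵥ v)
  have hGw : G *ᵥ (G⁻¹ *ᵥ v) = v := by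
    rw [mulVec_mulVec, mul_nonsing_inv _ ((isUnit_iff_isUnit_det G).1 hG.isUnit), one_mulVec]
  have hT : Gᵀ = G := by simpa using hG.isHermitian.eq
  have hwG : (G⁻¹ *ᵥ v) ⬝ᵥ G *ᵥ x = v ⬝ᵥ x := by
    rw [dotProduct_mulVec, ← mulVec_transpose, hT, hGw]
  simp only [star_trivial, mulVec_add, mulVec_smul, hGw, dotProduct_add, add_dotProduct,
    dotProduct_smul, smul_dotProduct, hwG, smul_eq_mul, dotProduct_comm x v,
    dotProduct_comm (G⁻¹ *ᵥ v) v] at h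
  linarith

/-- For a symmetric Lorentz-type matrix `g` whose spatial block `G` is
positive definite, with `|1 + g₀₀| ≤ η` and `vᵀ G⁻¹ v ≤ η` (where `v` is the shift row),
every causal vector `X` satisfies `X♭ᵀ G X♭ ≤ ((1 + √η + η)/(1 − √η)) (X⁰)²`. -/
theorem stmt_4 (n : ℕ) (hn : 1 ≤ n) (η : ℝ) (hη : η ∈ Set.Ioo (0 : ℝ) 1)
    (g : Matrix (Fin (n + 1)) (Fin (n + 1)) ℝ) (hsym : g.IsSymm)
    (G : Matrix (Fin n) (Fin n) ℝ) (hG : ∀ i j : Fin n, G i j = g i.succ j.succ)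
    (hGpd : G.PosDef)
    (v : Fin n → ℝ) (hv : ∀ i : Fin n, v i = g 0 i.succ)
    (h00 : |1 + g 0 0| ≤ η)
    (hvG : v ⬝ᵥ G⁻¹.mulVec v ≤ η) :
    ∀ X : Fin (n + 1) → ℝ,
      (∑ μ, ∑ ν, g μ ν * X μ * X ν) ≤ 0 →
      (∑ i, ∑ j, G i j * X i.succ * X j.succ)
        ≤ ((1 + Real.sqrt η + η) / (1 - Real.sqrt η)) * (X 0) ^ 2 := by
  intro X hX
  have hs : 0 < √η := Real.sqrt_pos.2 hη.1
  have hs1 : √η < 1 := by rw [Real.sqrt_lt' one_pos]; simpa using hη.2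
  have hsq : √η ^ 2 = η := Real.sq_sqrt hη.1.le
  have hQ : (fun i : Fin n => X i.succ) ⬝ᵥ G *ᵥ (fun i => X i.succ) =
      ∑ i, ∑ j, G i j * X i.succ * X j.succ := by
    simp only [dotProduct, mulVec, Finset.mul_sum]
    exact Finset.sum_congr rfl fun i _ => Finset.sum_congr rfl fun j _ => by ring
  have hsplit : ∑ μ, ∑ ν, g μ ν * X μ * X ν = g 0 0 * X 0 ^ 2 +
      2 * X 0 * (v ⬝ᵥ fun i => X i.succ) + ∑ i, ∑ j, G i j * X i.succ * X j.succ := by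
    have hr : ∑ j : Fin n, g 0 j.succ * X 0 * X j.succ =
        X 0 * (v ⬝ᵥ fun i => X i.succ) := by
      rw [dotProduct, Finset.mul_sum]
      exact Finset.sum_congr rfl fun j _ => by rw [hv]; ring
    have hc : ∑ j : Fin n, g j.succ 0 * X j.succ * X 0 =
        X 0 * (v ⬝ᵥ fun i => X i.succ) := by
      rw [dotProduct, Finset.mul_sum]
      exact Finset.sum_congr rfl fun j _ => by rw [hv, hsym.apply 0 j.succ]; ring
    simp only [Fin.sum_univ_succ, Finset.sum_add_distrib, hr, hc, hG]
    ring
  have hshift := hGpd.quadratic_shift_nonneg v (fun i => X i.succ) (X 0 / √η)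
  rw [hQ] at hshift
  rw [hsplit] at hX
  generalize (∑ i, ∑ j, G i j * X i.succ * X j.succ) = Q at *
  generalize (v ⬝ᵥ fun i => X i.succ) = p at *
  have hcross : 0 ≤ √η * Q + 2 * X 0 * p + √η * X 0 ^ 2 := by
    have hle : (X 0 / √η) ^ 2 * (v ⬝ᵥ G⁻¹ *ᵥ v) ≤ X 0 ^ 2 := by
      calc (X 0 / √η) ^ 2 * (v ⬝ᵥ G⁻¹ *ᵥ v) ≤ (X 0 / √η) ^ 2 * η := by gcongr
        _ = X 0 ^ 2 := by rw [div_pow, hsq, div_mul_cancel₀ _ hη.1.ne']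
    have h : 0 ≤ √η * (Q + 2 * (X 0 / √η) * p + X 0 ^ 2) :=
      mul_nonneg hs.le (by linarith)
    have he : √η * (Q + 2 * (X 0 / √η) * p + X 0 ^ 2) =
        √η * Q + 2 * X 0 * p + √η * X 0 ^ 2 := by
      field_simp
    rwa [he] at h
  have htime : 0 ≤ (1 + g 0 0 + η) * X 0 ^ 2 :=
    mul_nonneg (by linarith [(abs_le.1 h00).1]) (sq_nonneg _)
  rw [div_mul_eq_mul_div, le_div_iff₀ (by linarith)]
  linarith
end

section
/- Let n ≥ 3 be an integer and let p > 1, a > 0, c₁ > 1, η ∈ (0, 1), κ₀ ∈ ℝ and τ ≥ 0 be real numbers. Let g be a real symmetric (n+1)×(n+1) matrix with rows and columns indexed by 0, 1, …, n; write u[g] = 1 + g₀₀, v[g] = (g₀₁, …, g₀ₙ) ∈ ℝⁿ, and let g♭ = (g_{ij})_{1≤i,j≤n} denote the spatial block. Assume that for all w ∈ ℝⁿ: (1/c₁)|w|² ≤ e^{−2pτ−2κ₀}·wᵀg♭w ≤ c₁|w|², that |u[g]| ≤ η, and that |v[g]|² ≤ η·c₁⁻¹·e^{2pτ+2κ₀−2aτ}.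 (Under these assumptions g is invertible with Lorentzian signature; write g^{μν} for the entries of g⁻¹, u[g⁻¹] = 1 + g^{00}, v[g⁻¹] = (g^{01}, …, g^{0n}), and g♯ = (g^{ij})_{1≤i,j≤n}.) Then there exists a constant η₀ ∈ (0, 1/4), independent of g, p, a, c₁, κ₀ and τ, such that if η ≤ η₀ then: (i) |v[g⁻¹]| ≤ 2c₁·e^{−2pτ−2κ₀}·|v[g]|; (ii) |⟨v[g], v[g⁻¹]⟩| ≤ 2c₁·e^{−2pτ−2κ₀}·|v[g]|²; (iii) |u[g⁻¹]| ≤ 4η; and (iv) for all w ∈ ℝⁿ, (2/(3c₁))|w|² ≤ e^{2pτ+2κ₀}·wᵀg♯w ≤ (3c₁/2)|w|². -/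
open Matrix

section BorderedSystem

variable {ι : Type*} [Fintype ι]

theorem dotProduct_sq_le_mul (x y : ι → ℝ) : (x ⬝ᵥ y) ^ 2 ≤ (x ⬝ᵥ x) * (y ⬝ᵥ y) := by
  simpa [dotProduct, sq] using Finset.sum_mul_sq_le_sq_mul_sq Finset.univ x y

theorem dotProduct_self_nonneg_real (x : ι → ℝ) : 0 ≤ x ⬝ᵥ x :=
  Finset.sum_nonneg fun i _ => mul_self_nonneg (x i)

/-- A covector that is small relative to the coercivity constant of a quadratic form is
bounded by that form. -/
theorem dotProduct_sq_le_of_coercive {G : Matrix ι ι ℝ} {v y : ι → ℝ} {k η : ℝ}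
    (hk : 0 < k) (hG : y ⬝ᵥ y ≤ k * (y ⬝ᵥ G *ᵥ y)) (hv : k * (v ⬝ᵥ v) ≤ η) :
    (v ⬝ᵥ y) ^ 2 ≤ η * (y ⬝ᵥ G *ᵥ y) := by
  have h1 := dotProduct_sq_le_mul v y
  have hV := dotProduct_self_nonneg_real v
  have hQ : 0 ≤ y ⬝ᵥ G *ᵥ y :=
    nonneg_of_mul_nonneg_right ((dotProduct_self_nonneg_real y).trans hG) hk
  nlinarith [mul_le_mul_of_nonneg_left hG hV, mul_le_mul_of_nonneg_right hv hQ]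

theorem bordered_energy {G : Matrix ι ι ℝ} {v w y : ι → ℝ} {s x₀ : ℝ}
    (h₀ : s * x₀ + v ⬝ᵥ y = 0) (h₁ : x₀ • v + G *ᵥ y = w) :
    w ⬝ᵥ y = y ⬝ᵥ G *ᵥ y - s * x₀ ^ 2 := by
  rw [← h₁, add_dotProduct, smul_dotProduct, dotProduct_comm (G *ᵥ y) y, smul_eq_mul]
  linear_combination x₀ * h₀

theorem bordered_upper {G : Matrix ι ι ℝ} {v w y : ι → ℝ} {s x₀ k : ℝ}
    (hs : s ≤ 0) (hk : 0 < k) (hG : y ⬝ᵥ y ≤ k * (y ⬝ᵥ G *ᵥ y))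
    (h₀ : s * x₀ + v ⬝ᵥ y = 0) (h₁ : x₀ • v + G *ᵥ y = w) :
    w ⬝ᵥ y ≤ k * (w ⬝ᵥ w) := by
  have hP := bordered_energy h₀ h₁
  have hW := dotProduct_self_nonneg_real w
  have hc := dotProduct_sq_le_mul w y
  have hQ : y ⬝ᵥ G *ᵥ y ≤ w ⬝ᵥ y := by nlinarith [sq_nonneg x₀]
  have hY : y ⬝ᵥ y ≤ k * (w ⬝ᵥ y) := hG.trans (by gcongr)
  have hsq : (w ⬝ᵥ y) ^ 2 ≤ (w ⬝ᵥ w) * (k * (w ⬝ᵥ y)) :=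
    hc.trans (by gcongr)
  by_contra! hlt
  have hpos : 0 < w ⬝ᵥ y := lt_of_le_of_lt (by positivity) hlt
  nlinarith

theorem bordered_lower {G : Matrix ι ι ℝ} (hsymm : G.IsSymm) {v w y : ι → ℝ}
    {s x₀ c E : ℝ} (hs : s ≤ -(7 / 8)) (hc : 1 ≤ c) (hE : 0 < E)
    (hG : ∀ z, z ⬝ᵥ z ≤ c * E * (z ⬝ᵥ G *ᵥ z))
    (hG' : E * (w ⬝ᵥ G *ᵥ w) ≤ c * (w ⬝ᵥ w))
    (hv : c * E * (v ⬝ᵥ v) ≤ 1 / 8)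
    (h₀ : s * x₀ + v ⬝ᵥ y = 0) (h₁ : x₀ • v + G *ᵥ y = w) :
    2 * E * (w ⬝ᵥ w) ≤ 3 * c * (w ⬝ᵥ y) := by
  have hc0 : 0 < c := by linarith
  have hk : 0 < c * E := by positivity
  have hnn : ∀ z, 0 ≤ z ⬝ᵥ G *ᵥ z := fun z =>
    nonneg_of_mul_nonneg_right ((dotProduct_self_nonneg_real z).trans (hG z)) hk
  have hP := bordered_energy h₀ h₁
  have hW := dotProduct_self_nonneg_real w
  have hQ := hnn y
  have hcomm : y ⬝ᵥ G *ᵥ w = w ⬝ᵥ G *ᵥ y := by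
    rw [dotProduct_mulVec, ← mulVec_transpose, hsymm.eq, dotProduct_comm]
  have hvy := dotProduct_sq_le_of_coercive hk (hG y) hv
  have hx : x₀ ^ 2 ≤ 8 / 49 * (y ⬝ᵥ G *ᵥ y) := by
    have hsx : (v ⬝ᵥ y) ^ 2 = s ^ 2 * x₀ ^ 2 := by
      rw [eq_neg_of_add_eq_zero_right h₀]; ring
    have hs2 : 49 / 64 ≤ s ^ 2 := by nlinarith
    nlinarith [mul_le_mul_of_nonneg_right hs2 (sq_nonneg x₀)]
  have hvw : c * E * (v ⬝ᵥ w) ^ 2 ≤ 1 / 8 * (w ⬝ᵥ w) := by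
    nlinarith [mul_le_mul_of_nonneg_left (dotProduct_sq_le_mul v w) hk.le,
      mul_le_mul_of_nonneg_right hv hW]
  have hcross : 2 * (c * E) * (w ⬝ᵥ G *ᵥ y)
      ≤ E ^ 2 * (w ⬝ᵥ G *ᵥ w) + c ^ 2 * (y ⬝ᵥ G *ᵥ y) := by
    have h := hnn (E • w - c • y)
    simp only [mulVec_sub, mulVec_smul, sub_dotProduct, dotProduct_sub, smul_dotProduct,
      dotProduct_smul, smul_eq_mul, hcomm] at h
    linarith
  have hww : w ⬝ᵥ w = x₀ * (v ⬝ᵥ w) + w ⬝ᵥ G *ᵥ y := by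
    conv_lhs => rw [← h₁, add_dotProduct, smul_dotProduct, smul_eq_mul, h₁]
    rw [dotProduct_comm (G *ᵥ y) w]
  have hQP : y ⬝ᵥ G *ᵥ y ≤ w ⬝ᵥ y := by nlinarith [sq_nonneg x₀]
  have hc2 : y ⬝ᵥ G *ᵥ y ≤ c ^ 2 * (y ⬝ᵥ G *ᵥ y) := le_mul_of_one_le_left hQ (one_le_pow₀ hc)
  have hEW := mul_le_mul_of_nonneg_left hG' hE.le
  have hvw' := mul_le_mul_of_nonneg_left hvw hk.le
  have hyoung := sq_nonneg (x₀ - c * E * (v ⬝ᵥ w))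
  have hmain : 7 / 8 * (c * E * (w ⬝ᵥ w)) ≤ 57 / 49 * (c ^ 2 * (y ⬝ᵥ G *ᵥ y)) := by
    have hk2 : 2 * (c * E) * (w ⬝ᵥ w)
        = 2 * (c * E) * (x₀ * (v ⬝ᵥ w)) + 2 * (c * E) * (w ⬝ᵥ G *ᵥ y) := by
      linear_combination 2 * (c * E) * hww
    nlinarith
  have hQP' := mul_le_mul_of_nonneg_left hQP (sq_nonneg c)
  refine le_of_mul_le_mul_left ?_ hc0
  nlinarith

/-- The first column `(α, β)` of the inverse of a bordered matrix. -/
theorem bordered_first_column {G : Matrix ι ι ℝ} {v β : ι → ℝ} {s α k : ℝ}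
    (hs : s ≤ -(7 / 8)) (hk : 0 < k) (hG : β ⬝ᵥ β ≤ k * (β ⬝ᵥ G *ᵥ β))
    (h₀ : s * α + v ⬝ᵥ β = 1) (h₁ : α • v + G *ᵥ β = 0) :
    |α| ≤ 2 ∧ √(β ⬝ᵥ β) ≤ k * |α| * √(v ⬝ᵥ v) := by
  have hQ : β ⬝ᵥ G *ᵥ β = -α * (v ⬝ᵥ β) := by
    rw [eq_neg_of_add_eq_zero_right h₁, dotProduct_neg, dotProduct_smul, smul_eq_mul,
      dotProduct_comm]
    ring
  have hB := dotProduct_self_nonneg_real β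
  have hQnn : 0 ≤ β ⬝ᵥ G *ᵥ β := nonneg_of_mul_nonneg_right (hB.trans hG) hk
  have hα : 7 / 8 * α ^ 2 ≤ -α := by nlinarith [sq_nonneg α]
  refine ⟨by rw [abs_le]; constructor <;> nlinarith, ?_⟩
  have hvβ : |v ⬝ᵥ β| ≤ √(v ⬝ᵥ v) * √(β ⬝ᵥ β) := by
    rw [← Real.sqrt_mul (dotProduct_self_nonneg_real v)]
    exact Real.abs_le_sqrt (dotProduct_sq_le_mul v β)
  have hβ : √(β ⬝ᵥ β) * √(β ⬝ᵥ β) ≤ k * |α| * √(v ⬝ᵥ v) * √(β ⬝ᵥ β) := by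
    rw [Real.mul_self_sqrt hB]
    calc β ⬝ᵥ β ≤ k * (-α * (v ⬝ᵥ β)) := hQ ▸ hG
      _ ≤ k * (|α| * |v ⬝ᵥ β|) := by
          refine mul_le_mul_of_nonneg_left ?_ hk.le
          rw [← abs_mul, neg_mul]
          exact neg_le_abs _
      _ ≤ k * (|α| * (√(v ⬝ᵥ v) * √(β ⬝ᵥ β))) := by gcongr
      _ = _ := by ring
  rcases (Real.sqrt_nonneg (β ⬝ᵥ β)).eq_or_lt with h | h
  · rw [← h]; positivity
  · exact le_of_mul_le_mul_right hβ h

end BorderedSystem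

theorem mulVec_zero_eq_bordered {n : ℕ} (g : Matrix (Fin (n + 1)) (Fin (n + 1)) ℝ)
    (x : Fin (n + 1) → ℝ) :
    (g *ᵥ x) 0 = g 0 0 * x 0 + (fun i : Fin n => g 0 i.succ) ⬝ᵥ fun i => x i.succ := by
  simp [mulVec, dotProduct, Fin.sum_univ_succ]

theorem mulVec_succ_eq_bordered {n : ℕ} {g : Matrix (Fin (n + 1)) (Fin (n + 1)) ℝ}
    (hg : g.IsSymm) (x : Fin (n + 1) → ℝ) :
    (fun i : Fin n => (g *ᵥ x) i.succ)
      = x 0 • (fun i : Fin n => g 0 i.succ)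
        + g.submatrix Fin.succ Fin.succ *ᵥ fun i => x i.succ := by
  ext i
  simp [mulVec, dotProduct, Fin.sum_univ_succ, hg.apply 0 i.succ, mul_comm]

/-- A bordered matrix with negative corner and coercive symmetric block is invertible. -/
theorem bordered_isUnit_det {n : ℕ} {g : Matrix (Fin (n + 1)) (Fin (n + 1)) ℝ}
    (hg : g.IsSymm) {k : ℝ} (hs : g 0 0 < 0) (hk : 0 < k)
    (hG : ∀ z, z ⬝ᵥ z ≤ k * (z ⬝ᵥ g.submatrix Fin.succ Fin.succ *ᵥ z)) :
    IsUnit g.det := by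
  rw [isUnit_iff_ne_zero]
  intro hdet
  obtain ⟨x, hx, hgx⟩ := exists_mulVec_eq_zero_iff.mpr hdet
  have h₀ := mulVec_zero_eq_bordered g x
  have h₁ := mulVec_succ_eq_bordered hg x
  rw [hgx] at h₀ h₁
  have hP := bordered_energy h₀.symm h₁.symm
  have hz : (fun i : Fin n => (0 : Fin (n + 1) → ℝ) i.succ) = 0 := rfl
  rw [hz, zero_dotProduct] at hP
  have hY := hG fun i => x i.succ
  have hYnn := dotProduct_self_nonneg_real fun i : Fin n => x i.succ
  have hQnn := nonneg_of_mul_nonneg_right (hYnn.trans hY) hk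
  have hx0 : x 0 = 0 := by
    by_contra hne
    have : 0 < x 0 ^ 2 := by positivity
    nlinarith
  rw [hx0] at hP
  have hQ0 : (fun i : Fin n => x i.succ) ⬝ᵥ
      g.submatrix Fin.succ Fin.succ *ᵥ (fun i => x i.succ) = 0 := by linarith
  rw [hQ0, mul_zero] at hY
  have hy := dotProduct_self_eq_zero.mp (le_antisymm hY hYnn)
  exact hx (funext fun i => Fin.cases hx0 (fun j => congrFun hy j) i)

theorem sum_sum_eq_dotProduct_mulVec {n : ℕ} (g : Matrix (Fin (n + 1)) (Fin (n + 1)) ℝ)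
    (w : Fin n → ℝ) :
    ∑ i, ∑ j, g i.succ j.succ * w i * w j
      = w ⬝ᵥ g.submatrix Fin.succ Fin.succ *ᵥ w := by
  simp only [mulVec, dotProduct, submatrix_apply, Finset.mul_sum]
  exact Finset.sum_congr rfl fun i _ => Finset.sum_congr rfl fun j _ => by ring

/-- Control of the inverse metric under the primary bootstrap assumption:
there is a universal constant `η₀ ∈ (0, 1/4)` such that if the symmetric matrix `g`
satisfies the primary bootstrap inequalities with parameters `(p, a, c₁, η, κ₀)` at time
`τ` and `η ≤ η₀`, then the entries of `g⁻¹` satisfy the four listed estimates. -/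
theorem stmt_5 :
    ∃ η₀ : ℝ, η₀ ∈ Set.Ioo (0 : ℝ) (1 / 4) ∧
      ∀ (n : ℕ), 3 ≤ n →
      ∀ (p a c₁ η κ₀ τ : ℝ), 1 < p → 0 < a → 1 < c₁ → η ∈ Set.Ioo (0 : ℝ) 1 → 0 ≤ τ →
      ∀ g : Matrix (Fin (n + 1)) (Fin (n + 1)) ℝ, g.IsSymm →
      (∀ w : Fin n → ℝ,
        (1 / c₁) * (∑ i, (w i) ^ 2)
            ≤ Real.exp (-2 * p * τ - 2 * κ₀) * (∑ i, ∑ j, g i.succ j.succ * w i * w j) ∧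
          Real.exp (-2 * p * τ - 2 * κ₀) * (∑ i, ∑ j, g i.succ j.succ * w i * w j)
            ≤ c₁ * (∑ i, (w i) ^ 2)) →
      |1 + g 0 0| ≤ η →
      (∑ i : Fin n, (g 0 i.succ) ^ 2) ≤ η * c₁⁻¹ * Real.exp (2 * p * τ + 2 * κ₀ - 2 * a * τ) →
      η ≤ η₀ →
      (Real.sqrt (∑ i : Fin n, (g⁻¹ 0 i.succ) ^ 2)
          ≤ 2 * c₁ * Real.exp (-2 * p * τ - 2 * κ₀) * Real.sqrt (∑ i : Fin n, (g 0 i.succ) ^ 2)) ∧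
      (|∑ i : Fin n, g 0 i.succ * g⁻¹ 0 i.succ|
          ≤ 2 * c₁ * Real.exp (-2 * p * τ - 2 * κ₀) * (∑ i : Fin n, (g 0 i.succ) ^ 2)) ∧
      (|1 + g⁻¹ 0 0| ≤ 4 * η) ∧
      (∀ w : Fin n → ℝ,
        (2 / (3 * c₁)) * (∑ i, (w i) ^ 2)
            ≤ Real.exp (2 * p * τ + 2 * κ₀) * (∑ i, ∑ j, g⁻¹ i.succ j.succ * w i * w j) ∧
          Real.exp (2 * p * τ + 2 * κ₀) * (∑ i, ∑ j, g⁻¹ i.succ j.succ * w i * w j)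
            ≤ (3 * c₁ / 2) * (∑ i, (w i) ^ 2)) := by
  refine ⟨1 / 8, by norm_num, ?_⟩
  intro n _ p a c η κ τ _ ha hc hη hτ g hg hspat hu hv hη₀
  have hsum : ∀ w : Fin n → ℝ, ∑ i, w i ^ 2 = w ⬝ᵥ w := fun w => by simp [dotProduct, sq]
  have hsumv := hsum fun i => g 0 i.succ
  simp only [hsum, sum_sum_eq_dotProduct_mulVec] at hspat ⊢
  simp only [hsumv] at hv ⊢
  have hc0 : 0 < c := by linarith
  have hEinv : Real.exp (2 * p * τ + 2 * κ) = (Real.exp (-2 * p * τ - 2 * κ))⁻¹ := by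
    rw [← Real.exp_neg]; ring_nf
  have hexp : Real.exp (2 * p * τ + 2 * κ - 2 * a * τ)
      ≤ (Real.exp (-2 * p * τ - 2 * κ))⁻¹ := by
    rw [← hEinv]
    exact Real.exp_le_exp.mpr (by nlinarith [mul_nonneg ha.le hτ])
  rw [hEinv]
  have hE := Real.exp_pos (-2 * p * τ - 2 * κ)
  generalize Real.exp (-2 * p * τ - 2 * κ) = E at *
  have hk : 0 < c * E := by positivity
  set v : Fin n → ℝ := fun i => g 0 i.succ
  set β : Fin n → ℝ := fun i => g⁻¹ 0 i.succ
  have hv' : c * E * (v ⬝ᵥ v) ≤ η := by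
    have hη0 := hη.1
    calc c * E * (v ⬝ᵥ v) ≤ c * E * (η * c⁻¹ * E⁻¹) := by
          gcongr
          exact hv.trans (by gcongr)
      _ = η := by field_simp
  have hG : ∀ z, z ⬝ᵥ z ≤ c * E * (z ⬝ᵥ g.submatrix Fin.succ Fin.succ *ᵥ z) := fun z => by
    have h := mul_le_mul_of_nonneg_left (hspat z).1 hc0.le
    rwa [← mul_assoc, mul_one_div_cancel hc0.ne', one_mul, ← mul_assoc] at h
  have hs : g 0 0 ≤ -(7 / 8) := by linarith [(abs_le.mp hu).2]
  have hdet := bordered_isUnit_det hg (by linarith) hk hG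
  have hinv : ∀ x, g *ᵥ (g⁻¹ *ᵥ x) = x := fun x => by
    rw [mulVec_mulVec, mul_nonsing_inv g hdet, one_mulVec]
  have hginv : g⁻¹.IsSymm := by
    rw [IsSymm, transpose_nonsing_inv, hg.eq]
  have hcol : g⁻¹ *ᵥ Pi.single 0 1 = fun i => g⁻¹ 0 i := by
    ext i; rw [mulVec_single_one]; exact hginv.apply 0 i
  have hα₀ : g 0 0 * g⁻¹ 0 0 + v ⬝ᵥ β = 1 := by
    have h := mulVec_zero_eq_bordered g (g⁻¹ *ᵥ Pi.single 0 1)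
    rw [hinv, hcol] at h
    simpa using h.symm
  have hα₁ : g⁻¹ 0 0 • v + g.submatrix Fin.succ Fin.succ *ᵥ β = 0 := by
    have h := mulVec_succ_eq_bordered hg (g⁻¹ *ᵥ Pi.single 0 1)
    rw [hinv, hcol] at h
    rw [← h]
    ext i
    simp
  obtain ⟨hα, hβ⟩ := bordered_first_column hs hk (hG β) hα₀ hα₁
  have hV := dotProduct_self_nonneg_real v
  have hvβ : |v ⬝ᵥ β| ≤ c * E * |g⁻¹ 0 0| * (v ⬝ᵥ v) := by
    calc |v ⬝ᵥ β| ≤ √(v ⬝ᵥ v) * √(β ⬝ᵥ β) := by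
          rw [← Real.sqrt_mul hV]
          exact Real.abs_le_sqrt (dotProduct_sq_le_mul v β)
      _ ≤ √(v ⬝ᵥ v) * (c * E * |g⁻¹ 0 0| * √(v ⬝ᵥ v)) := by gcongr
      _ = c * E * |g⁻¹ 0 0| * (√(v ⬝ᵥ v) * √(v ⬝ᵥ v)) := by ring
      _ = _ := by rw [Real.mul_self_sqrt hV]
  refine ⟨?_, ?_, ?_, fun w => ?_⟩
  · calc √(β ⬝ᵥ β) ≤ c * E * |g⁻¹ 0 0| * √(v ⬝ᵥ v) := hβ
      _ ≤ c * E * 2 * √(v ⬝ᵥ v) := by gcongr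
      _ = _ := by ring
  · calc |v ⬝ᵥ β| ≤ c * E * |g⁻¹ 0 0| * (v ⬝ᵥ v) := hvβ
      _ ≤ c * E * 2 * (v ⬝ᵥ v) := by gcongr
      _ = _ := by ring
  · have hη0 := hη.1
    calc |1 + g⁻¹ 0 0| = |(1 + g 0 0) * g⁻¹ 0 0 + v ⬝ᵥ β| := by
          congr 1; linear_combination -hα₀
      _ ≤ |1 + g 0 0| * |g⁻¹ 0 0| + |v ⬝ᵥ β| := by
          rw [← abs_mul]; exact abs_add_le _ _
      _ ≤ η * |g⁻¹ 0 0| + c * E * |g⁻¹ 0 0| * (v ⬝ᵥ v) := by gcongr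
      _ = |g⁻¹ 0 0| * (η + c * E * (v ⬝ᵥ v)) := by ring
      _ ≤ 2 * (η + η) := by gcongr
      _ = 4 * η := by ring
  · have hx : (fun i : Fin n => (g⁻¹ *ᵥ Fin.cons 0 w) i.succ)
        = g⁻¹.submatrix Fin.succ Fin.succ *ᵥ w := by
      rw [mulVec_succ_eq_bordered hginv]
      simp
    have h₀ := mulVec_zero_eq_bordered g (g⁻¹ *ᵥ Fin.cons 0 w)
    have h₁ := mulVec_succ_eq_bordered hg (g⁻¹ *ᵥ Fin.cons 0 w)
    rw [hinv, hx, Fin.cons_zero] at h₀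
    rw [hinv, hx] at h₁
    simp only [Fin.cons_succ] at h₁
    have hlow := bordered_lower (hg.submatrix Fin.succ) hs hc.le hE hG (hspat w).2 (hv'.trans hη₀)
      h₀.symm h₁.symm
    have hup := bordered_upper (by linarith) hk (hG _) h₀.symm h₁.symm
    have hW := dotProduct_self_nonneg_real w
    constructor
    · rw [inv_mul_eq_div, le_div_iff₀ hE, div_mul_eq_mul_div, div_mul_eq_mul_div,
        div_le_iff₀ (by positivity)]
      linarith
    · rw [inv_mul_le_iff₀ hE]
      nlinarith [mul_nonneg hk.le hW]
end

section
/- Let a > 0, K ≥ 0 and t₀ > 0 be real numbers, let s₁ ∈ ℝ and s_max ∈ (s₁, ∞], and let f : [s₁, s_max) → ℝ be twice continuously differentiable with f(s₁) ≥ t₀, f'(s) > 0 for all s ∈ [s₁, s_max), and f''(s) ≤ K·f(s)⁻¹·(f(s)/t₀)^{−a}·f'(s)² for all s ∈ [s₁, s_max). Then: (i) f'(s) ≤ f'(s₁)·e^{K/a} for all s ∈ [s₁, s_max); and (ii) if f(s) → ∞ as s → s_max, then s_max = ∞. -/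
/-- If `f'' ≤ K f⁻¹ (f / t₀) ^ (-a) (f')²` on a convex set where `f` and `f'` are positive, then
`log f' + (K / a) (f / t₀) ^ (-a)` is nonincreasing there. -/
theorem antitoneOn_log_add_rpow_of_deriv_le {a K t₀ : ℝ} (ha : a ≠ 0) (ht₀ : 0 < t₀)
    {S : Set ℝ} (hS : Convex ℝ S) {f f' f'' : ℝ → ℝ}
    (hd1 : ∀ s ∈ S, HasDerivWithinAt f (f' s) S s)
    (hd2 : ∀ s ∈ S, HasDerivWithinAt f' (f'' s) S s)
    (hf : ∀ s ∈ S, 0 < f s) (hf' : ∀ s ∈ S, 0 < f' s)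
    (hineq : ∀ s ∈ S, f'' s ≤ K * (f s)⁻¹ * (f s / t₀) ^ (-a) * (f' s) ^ 2) :
    AntitoneOn (fun s => Real.log (f' s) + K / a * (f s / t₀) ^ (-a)) S := by
  have hd : ∀ s ∈ S, HasDerivWithinAt (fun s => Real.log (f' s) + K / a * (f s / t₀) ^ (-a))
      (f'' s / f' s + K / a * (f' s / t₀ * (-a) * (f s / t₀) ^ (-a - 1))) S s := fun s hs =>
    ((hd2 s hs).log (hf' s hs).ne').add
      ((((hd1 s hs).div_const t₀).rpow_const (Or.inl (div_pos (hf s hs) ht₀).ne')).const_mul _)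
  refine antitoneOn_of_hasDerivWithinAt_nonpos hS (fun s hs => (hd s hs).continuousWithinAt)
    (fun s hs => (hd s (interior_subset hs)).mono interior_subset) fun s hs => ?_
  have hs := interior_subset hs
  have hfs := hf s hs
  have hfs' := hf' s hs
  have hdiv : f'' s / f' s ≤ K * (f s)⁻¹ * (f s / t₀) ^ (-a) * f' s := by
    rw [div_le_iff₀ hfs']
    linarith [hineq s hs]
  have hcancel : K / a * (f' s / t₀ * (-a) * (f s / t₀) ^ (-a - 1)) =
      -(K * (f s)⁻¹ * (f s / t₀) ^ (-a) * f' s) := by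
    rw [Real.rpow_sub_one (div_pos hfs ht₀).ne']
    field_simp
  linarith

/-- Geodesic-completeness ODE argument: if `f` is `C²` on `[s₁, s_max)`
with `f(s₁) ≥ t₀`, `f' > 0`, and `f'' ≤ K f⁻¹ (f/t₀)^{−a} (f')²`, then
(i) `f'(s) ≤ f'(s₁) e^{K/a}` throughout, and (ii) if `f(s) → ∞` as `s → s_max`,
then `s_max = ∞`. -/
theorem stmt_13 (a K t₀ : ℝ) (ha : 0 < a) (hK : 0 ≤ K) (ht₀ : 0 < t₀)
    (s₁ : ℝ) (smax : EReal) (hs : (s₁ : EReal) < smax)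
    (f f' f'' : ℝ → ℝ)
    (hd1 : ∀ s : ℝ, s₁ ≤ s → (s : EReal) < smax →
      HasDerivWithinAt f (f' s) {u : ℝ | s₁ ≤ u ∧ (u : EReal) < smax} s)
    (hd2 : ∀ s : ℝ, s₁ ≤ s → (s : EReal) < smax →
      HasDerivWithinAt f' (f'' s) {u : ℝ | s₁ ≤ u ∧ (u : EReal) < smax} s)
    (hcont : ContinuousOn f'' {u : ℝ | s₁ ≤ u ∧ (u : EReal) < smax})
    (hinit : t₀ ≤ f s₁)
    (hpos : ∀ s : ℝ, s₁ ≤ s → (s : EReal) < smax → 0 < f' s)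
    (hineq : ∀ s : ℝ, s₁ ≤ s → (s : EReal) < smax →
      f'' s ≤ K * (f s)⁻¹ * (f s / t₀) ^ (-a) * (f' s) ^ 2) :
    (∀ s : ℝ, s₁ ≤ s → (s : EReal) < smax → f' s ≤ f' s₁ * Real.exp (K / a)) ∧
    (Filter.Tendsto f
        (Filter.comap (fun s : ℝ => (s : EReal)) (nhdsWithin smax (Set.Iio smax)))
        Filter.atTop →
      smax = ⊤) := by
  set S : Set ℝ := {u : ℝ | s₁ ≤ u ∧ (u : EReal) < smax}
  have hS : Convex ℝ S := by
    refine Set.OrdConnected.convex ⟨fun x hx y hy z hz => ⟨hx.1.trans hz.1, ?_⟩⟩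
    exact (EReal.coe_le_coe_iff.2 hz.2).trans_lt hy.2
  have hs₁ : s₁ ∈ S := ⟨le_rfl, hs⟩
  have hmono : MonotoneOn f S :=
    monotoneOn_of_hasDerivWithinAt_nonneg hS
      (fun s hs => (hd1 s hs.1 hs.2).continuousWithinAt)
      (fun s hs => (hd1 s (interior_subset hs).1 (interior_subset hs).2).mono interior_subset)
      (fun s hs => (hpos s (interior_subset hs).1 (interior_subset hs).2).le)
  have hfpos : ∀ s ∈ S, 0 < f s := fun s hs =>
    ht₀.trans_le (hinit.trans (hmono hs₁ hs hs.1))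
  have hanti := antitoneOn_log_add_rpow_of_deriv_le ha.ne' ht₀ hS
    (fun s hs => hd1 s hs.1 hs.2) (fun s hs => hd2 s hs.1 hs.2) hfpos
    (fun s hs => hpos s hs.1 hs.2) (fun s hs => hineq s hs.1 hs.2)
  have hbound : ∀ s ∈ S, f' s ≤ f' s₁ * Real.exp (K / a) := by
    intro s hsS
    have hle := hanti hs₁ hsS hsS.1
    have hKa : 0 ≤ K / a := div_nonneg hK ha.le
    have hend : 0 ≤ K / a * (f s / t₀) ^ (-a) :=
      mul_nonneg hKa (Real.rpow_nonneg (div_pos (hfpos s hsS) ht₀).le _)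
    have hstart : K / a * (f s₁ / t₀) ^ (-a) ≤ K / a :=
      mul_le_of_le_one_right hKa
        (Real.rpow_le_one_of_one_le_of_nonpos ((one_le_div ht₀).2 hinit) (neg_nonpos.2 ha.le))
    have hf's := hpos s hsS.1 hsS.2
    have hf's₁ := hpos s₁ le_rfl hs
    rw [← Real.log_le_log_iff hf's (by positivity), Real.log_mul hf's₁.ne' (Real.exp_pos _).ne',
      Real.log_exp]
    simp only at hle
    linarith
  refine ⟨fun s h h' => hbound s ⟨h, h'⟩, fun hlim => ?_⟩
  by_contra htop
  obtain ⟨T, rfl⟩ : ∃ T : ℝ, (T : EReal) = smax :=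
    ⟨smax.toReal, EReal.coe_toReal htop (bot_le.trans_lt hs).ne'⟩
  have hs₁T : s₁ < T := EReal.coe_lt_coe_iff.1 hs
  set M := f' s₁ * Real.exp (K / a)
  have hM : 0 ≤ M := mul_nonneg (hpos s₁ le_rfl hs).le (Real.exp_pos _).le
  have hlin : AntitoneOn (fun s => f s - M * s) S :=
    antitoneOn_of_hasDerivWithinAt_nonpos (f' := fun s => f' s - M * 1) hS
      (fun s hs => (hd1 s hs.1 hs.2).continuousWithinAt.sub (by fun_prop))
      (fun s hs => ((hd1 s (interior_subset hs).1 (interior_subset hs).2).mono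
        interior_subset).sub ((hasDerivWithinAt_id s _).const_mul M))
      (fun s hs => by linarith [hbound s (interior_subset hs)])
  have hcoe : Filter.Tendsto (fun s : ℝ => (s : EReal)) (nhdsWithin T (Set.Iio T))
      (nhdsWithin (T : EReal) (Set.Iio (T : EReal))) :=
    continuous_coe_real_ereal.continuousWithinAt.tendsto_nhdsWithin
      fun s hs => EReal.coe_lt_coe_iff.2 hs
  have hlarge := (hlim.mono_left hcoe.le_comap).eventually_gt_atTop (f s₁ + M * (T - s₁))
  obtain ⟨s, hfs, hs₁s, hsT⟩ := (hlarge.and (Ioo_mem_nhdsLT hs₁T)).exists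
  have hle := hlin hs₁ ⟨hs₁s.le, EReal.coe_lt_coe_iff.2 hsT⟩ hs₁s.le
  have hMs : M * s ≤ M * T := mul_le_mul_of_nonneg_left hsT.le hM
  simp only at hle
  linarith
end

section
/- Fix an integer n ≥ 3, a real number L > 2, and an integer m with m > n/2 + 1. Let B_{ij} (1 ≤ i, j ≤ n) be smooth functions on ℝⁿ, periodic with period L in each coordinate, satisfying B_{ij} = −B_{ji} and the closedness condition ∂_k B_{ij} + ∂_i B_{jk} + ∂_j B_{ki} = 0 for all i, j, k, and such that the support of each B_{ij} intersected with the fundamental domain [−L/2, L/2]ⁿ is contained in the open unit ball B₁(0) centered at the origin. Then: (i) there exist smooth functions A_i on ℝⁿ, periodic with period L in each coordinate, such that ∂_i A_j − ∂_j A_i = B_{ij} for all i, j; and (ii) for every ε > 0 there exists δ > 0 (depending only on n, m, L and ε) such that if Σ_{i,j} ‖B_{ij}‖_{H^m} ≤ δ, then the A_i can be chosen so that Σ_i ‖A_i‖_{H^{m+1}} ≤ ε. -/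
open MeasureTheory

/-- Spatial partial derivative `∂_i f` of a function on `ℝⁿ`. -/
noncomputable def pd {n : ℕ} (i : Fin n) (f : (Fin n → ℝ) → ℝ) : (Fin n → ℝ) → ℝ :=
  fun x => deriv (fun t => f (Function.update x i t)) (x i)

/-- Iterated partial derivative `∂^μ` for a multi-index `μ`. -/
noncomputable def pdPow {n : ℕ} (μ : Fin n → ℕ) (f : (Fin n → ℝ) → ℝ) :
    (Fin n → ℝ) → ℝ :=
  (List.ofFn (fun i : Fin n => (pd i)^[μ i])).foldr (fun d h => d h) f

/-- The Sobolev norm `‖f‖_{H^k}` of an `L`-periodic function on `ℝⁿ`, computed over the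
fundamental domain `[−L/2, L/2]ⁿ`. -/
noncomputable def sobNorm (n : ℕ) (L : ℝ) (k : ℕ) (f : (Fin n → ℝ) → ℝ) : ℝ :=
  Real.sqrt (∑ μ ∈ Finset.univ.filter (fun μ : Fin n → Fin (k + 1) => (∑ i, (μ i : ℕ)) ≤ k),
    ∫ x in Set.Icc (fun _ => -L / 2 : Fin n → ℝ) (fun _ => L / 2),
      (pdPow (fun i => (μ i : ℕ)) f x) ^ 2)

/-- Magnetic initial data on the torus `ℝⁿ/(Lℤⁿ)`: a smooth `L`-periodic closed 2-form
whose support, intersected with the fundamental domain `[−L/2, L/2]ⁿ`, is contained in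
the open Euclidean unit ball centered at the origin. -/
def GoodB (n : ℕ) (L : ℝ) (B : Fin n → Fin n → (Fin n → ℝ) → ℝ) : Prop :=
  (∀ i j, ContDiff ℝ (⊤ : ℕ∞) (B i j)) ∧
  (∀ i j (x : Fin n → ℝ) (k : Fin n → ℤ),
    B i j (x + fun l => L * (k l : ℝ)) = B i j x) ∧
  (∀ i j (x : Fin n → ℝ), B i j x = -B j i x) ∧
  (∀ i j k (x : Fin n → ℝ), pd k (B i j) x + pd i (B j k) x + pd j (B k i) x = 0) ∧
  (∀ i j (x : Fin n → ℝ),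
    x ∈ Set.Icc (fun _ => -L / 2 : Fin n → ℝ) (fun _ => L / 2) →
    1 ≤ ∑ l, (x l) ^ 2 → B i j x = 0)

namespace TorusPotential

open scoped ContDiff Pointwise

variable {n : ℕ} {L : ℝ}

/-- The fundamental domain `[-L/2, L/2]ⁿ`. -/
abbrev cube (n : ℕ) (L : ℝ) : Set (Fin n → ℝ) :=
  Set.Icc (fun _ => -L / 2 : Fin n → ℝ) (fun _ => L / 2)

/-- Periodicity with period `L` in each coordinate. -/
def IsPeriodic {E : Type*} (L : ℝ) (f : (Fin n → ℝ) → E) : Prop :=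
  ∀ (x : Fin n → ℝ) (k : Fin n → ℤ), f (x + fun l => L * (k l : ℝ)) = f x

/-- Smooth real functions on the torus. -/
structure SmoothPeriodic (L : ℝ) (f : (Fin n → ℝ) → ℝ) : Prop where
  contDiff : ContDiff ℝ ∞ f
  periodic : IsPeriodic L f

/-- The `i`-th component of the frequency vector attached to `k ∈ ℤⁿ`. -/
noncomputable def freq (L : ℝ) (k : Fin n → ℤ) (i : Fin n) : ℝ := 2 * Real.pi / L * k i

/-- The phase `⟨freq k, x⟩` as a continuous linear map. -/
noncomputable def phase (L : ℝ) (k : Fin n → ℤ) : (Fin n → ℝ) →L[ℝ] ℝ :=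
  ∑ i, freq L k i • ContinuousLinearMap.proj i

/-- The plane wave `exp (i⟨freq k, x⟩)`. -/
noncomputable def wave (L : ℝ) (k : Fin n → ℤ) (x : Fin n → ℝ) : ℂ :=
  Complex.exp (phase L k x * Complex.I)

/-- The Fourier coefficient of a function on the torus of period `L`. -/
noncomputable def coef (L : ℝ) (f : (Fin n → ℝ) → ℝ) (k : Fin n → ℤ) : ℂ :=
  ((L : ℂ) ^ n)⁻¹ * ∫ x in cube n L, wave L (-k) x * f x

lemma phase_apply (k : Fin n → ℤ) (x : Fin n → ℝ) :
    phase L k x = ∑ i, freq L k i * x i := by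
  simp [phase]

lemma phase_single (k : Fin n → ℤ) (i : Fin n) :
    phase L k (Pi.single i 1) = freq L k i := by
  simp [phase_apply, Pi.single_apply]

lemma freq_neg (k : Fin n → ℤ) (i : Fin n) : freq L (-k) i = -freq L k i := by
  simp [freq]

lemma freq_zero (i : Fin n) : freq L (0 : Fin n → ℤ) i = 0 := by simp [freq]

lemma norm_wave (k : Fin n → ℤ) (x : Fin n → ℝ) : ‖wave L k x‖ = 1 := by
  simp [wave, Complex.norm_exp_ofReal_mul_I]

lemma contDiff_wave (k : Fin n → ℤ) : ContDiff ℝ ∞ (wave L k) := by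
  unfold wave
  have : ContDiff ℝ ∞ (fun x => ((phase L k x : ℝ) : ℂ)) :=
    Complex.ofRealCLM.contDiff.comp (phase L k).contDiff
  fun_prop

lemma wave_periodic (hL : L ≠ 0) (k : Fin n → ℤ) : IsPeriodic L (wave L k) := by
  intro x l
  have h : phase L k (fun i => L * (l i : ℝ)) = ((∑ i, k i * l i : ℤ) : ℝ) * (2 * Real.pi) := by
    rw [phase_apply]
    push_cast
    rw [Finset.sum_mul]
    refine Finset.sum_congr rfl fun i _ => ?_
    unfold freq
    field_simp
  unfold wave
  rw [map_add, h]
  rw [Complex.exp_eq_exp_iff_exists_int]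
  exact ⟨∑ i, k i * l i, by push_cast; ring⟩

lemma pd_eq_fderiv {f : (Fin n → ℝ) → ℝ} (hf : Differentiable ℝ f) (i : Fin n)
    (x : Fin n → ℝ) : pd i f x = fderiv ℝ f x (Pi.single i 1) := by
  have h1 : HasFDerivAt f (fderiv ℝ f x) (Function.update x i (x i)) := by
    rw [Function.update_eq_self]
    exact (hf x).hasFDerivAt
  exact (h1.comp_hasDerivAt (x i) (hasDerivAt_update x i (x i))).deriv

lemma SmoothPeriodic.differentiable {f : (Fin n → ℝ) → ℝ} (hf : SmoothPeriodic L f) :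
    Differentiable ℝ f := hf.contDiff.differentiable (by simp)

lemma SmoothPeriodic.pd {f : (Fin n → ℝ) → ℝ} (hf : SmoothPeriodic L f) (i : Fin n) :
    SmoothPeriodic L (pd i f) := by
  have h : _root_.pd i f = fun x => fderiv ℝ f x (Pi.single i 1) :=
    funext fun x => pd_eq_fderiv hf.differentiable i x
  rw [h]
  constructor
  · exact (hf.contDiff.fderiv_right (m := ∞) (by simp)).clm_apply contDiff_const
  · intro x k
    have h2 : (fun y => f (y + fun l => L * (k l : ℝ))) = f := funext fun y => hf.periodic y k
    simp only
    rw [← fderiv_comp_add_right, h2]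

/-- The integral over the cube of a partial derivative vanishes when the function takes the
same values on opposite faces. -/
lemma integral_fderiv_single_eq_zero (hL : 0 ≤ L) {G : (Fin n → ℝ) → ℂ} (hG : ContDiff ℝ ∞ G)
    (i : Fin n)
    (hper : ∀ x ∈ cube n L, G (Function.update x i (L / 2)) = G (Function.update x i (-L / 2))) :
    ∫ x in cube n L, fderiv ℝ G x (Pi.single i 1) = 0 := by
  obtain _ | p := n
  · exact i.elim0
  have hle : (fun _ => -L / 2 : Fin (p + 1) → ℝ) ≤ fun _ => L / 2 := fun _ => by linarith
  have hd : Differentiable ℝ G := hG.differentiable (by simp)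
  have hc : Continuous fun x => fderiv ℝ G x (Pi.single i 1) :=
    ((hG.continuous_fderiv (by simp)).clm_apply continuous_const)
  have hsum : ∀ x, ∑ j, (if j = i then fderiv ℝ G x else 0) (Pi.single j 1)
      = fderiv ℝ G x (Pi.single i 1) := by
    intro x
    rw [Finset.sum_eq_single i] <;> simp +contextual
  have key := integral_divergence_of_hasFDerivAt_off_countable'
    (fun _ => -L / 2 : Fin (p + 1) → ℝ) (fun _ => L / 2) hle
    (fun j => if j = i then G else 0) (fun j x => if j = i then fderiv ℝ G x else 0) ∅
    Set.countable_empty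
    (fun j => by
      split_ifs
      · exact hG.continuous.continuousOn
      · exact continuousOn_const)
    (fun x _ j => by
      split_ifs
      · exact (hd x).hasFDerivAt
      · exact hasFDerivAt_const _ _)
    (by
      simp only [hsum]
      exact hc.continuousOn.integrableOn_compact isCompact_Icc)
  simp only [hsum] at key
  rw [key]
  refine Finset.sum_eq_zero fun j _ => ?_
  split_ifs with hj
  · subst hj
    rw [sub_eq_zero]
    refine setIntegral_congr_fun measurableSet_Icc fun y hy => ?_
    have hmem : j.insertNth (L / 2) y ∈ cube (p + 1) L := by
      constructor
      · intro l
        refine Fin.succAboveCases j ?_ (fun q => ?_) l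
        · simp; linarith
        · simpa using hy.1 q
      · intro l
        refine Fin.succAboveCases j ?_ (fun q => ?_) l
        · simp
        · simpa using hy.2 q
    simpa using hper _ hmem
  · simp

lemma IsPeriodic.update_eq {E : Type*} {G : (Fin n → ℝ) → E} (hG : IsPeriodic L G)
    (x : Fin n → ℝ) (i : Fin n) :
    G (Function.update x i (L / 2)) = G (Function.update x i (-L / 2)) := by
  rw [← hG (Function.update x i (-L / 2)) (Pi.single i 1)]
  congr 1
  ext j
  by_cases h : j = i
  · subst h
    simp
    ring
  · simp [h]

lemma hasFDerivAt_wave (k : Fin n → ℤ) (x : Fin n → ℝ) :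
    HasFDerivAt (wave L k)
      (wave L k x • (phase L k).smulRight Complex.I : (Fin n → ℝ) →L[ℝ] ℂ) x := by
  have h1 : HasFDerivAt (fun x => (phase L k x : ℂ) * Complex.I)
      ((phase L k).smulRight Complex.I : (Fin n → ℝ) →L[ℝ] ℂ) x := by
    have := ((phase L k).smulRight Complex.I : (Fin n → ℝ) →L[ℝ] ℂ).hasFDerivAt (x := x)
    simpa using! this
  exact h1.cexp

lemma fderiv_wave_single (k : Fin n → ℤ) (i : Fin n) (x : Fin n → ℝ) :
    fderiv ℝ (wave L k) x (Pi.single i 1) = Complex.I * freq L k i * wave L k x := by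
  rw [(hasFDerivAt_wave k x).fderiv]
  simp [phase_single]
  ring

lemma continuous_wave (k : Fin n → ℤ) : Continuous (wave L k) := (contDiff_wave k).continuous

lemma integrableOn_wave_mul {f : (Fin n → ℝ) → ℝ} (hf : Continuous f) (k : Fin n → ℤ) :
    IntegrableOn (fun x => wave L k x * f x) (cube n L) :=
  ((continuous_wave k).mul (Complex.continuous_ofReal.comp hf)).continuousOn.integrableOn_compact
    isCompact_Icc

lemma coef_pd (hL : 0 < L) {f : (Fin n → ℝ) → ℝ} (hf : SmoothPeriodic L f) (i : Fin n)
    (k : Fin n → ℤ) : coef L (pd i f) k = Complex.I * freq L k i * coef L f k := by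
  have hfC : ContDiff ℝ ∞ (fun x => (f x : ℂ)) := Complex.ofRealCLM.contDiff.comp hf.contDiff
  have hG : ContDiff ℝ ∞ (fun x => wave L (-k) x * (f x : ℂ)) := (contDiff_wave _).mul hfC
  have hper : IsPeriodic L (fun x => wave L (-k) x * (f x : ℂ)) := fun x l => by
    simp only [wave_periodic hL.ne' (-k) x l, hf.periodic x l]
  have h0 := integral_fderiv_single_eq_zero hL.le hG i fun x _ => hper.update_eq x i
  have hder : ∀ x, fderiv ℝ (fun x => wave L (-k) x * (f x : ℂ)) x (Pi.single i 1) =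
      wave L (-k) x * (pd i f x : ℝ) - Complex.I * freq L k i * (wave L (-k) x * (f x : ℂ)) := by
    intro x
    have hf1 : HasFDerivAt (fun x => (f x : ℂ)) (Complex.ofRealCLM.comp (fderiv ℝ f x)) x :=
      Complex.ofRealCLM.hasFDerivAt.comp x (hf.differentiable x).hasFDerivAt
    have hw : DifferentiableAt ℝ (wave L (-k)) x := (hasFDerivAt_wave _ x).differentiableAt
    rw [(hw.hasFDerivAt.fun_mul hf1).fderiv, pd_eq_fderiv hf.differentiable]
    simp only [add_apply, smul_apply, fderiv_wave_single,
      freq_neg, ContinuousLinearMap.comp_apply, Complex.ofRealCLM_apply, smul_eq_mul]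
    push_cast
    ring
  simp only [hder] at h0
  rw [integral_sub (integrableOn_wave_mul (hf.pd i).contDiff.continuous _)
    ((integrableOn_wave_mul hf.contDiff.continuous _).const_mul _), integral_const_mul,
    sub_eq_zero] at h0
  unfold coef
  rw [h0]
  ring

lemma SmoothPeriodic.sub {f g : (Fin n → ℝ) → ℝ} (hf : SmoothPeriodic L f)
    (hg : SmoothPeriodic L g) : SmoothPeriodic L (fun x => f x - g x) :=
  ⟨hf.contDiff.sub hg.contDiff, fun x k => by rw [hf.periodic, hg.periodic]⟩

lemma SmoothPeriodic.const_mul {f : (Fin n → ℝ) → ℝ} (hf : SmoothPeriodic L f) (c : ℝ) :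
    SmoothPeriodic L (fun x => c * f x) :=
  ⟨contDiff_const.mul hf.contDiff, fun x k => by rw [hf.periodic]⟩

lemma SmoothPeriodic.sum {ι : Type*} {s : Finset ι} {f : ι → (Fin n → ℝ) → ℝ}
    (hf : ∀ i, SmoothPeriodic L (f i)) : SmoothPeriodic L (fun x => ∑ i ∈ s, f i x) :=
  ⟨ContDiff.sum fun i _ => (hf i).contDiff,
    fun x k => Finset.sum_congr rfl fun i _ => (hf i).periodic x k⟩

lemma smoothPeriodic_const (c : ℝ) : SmoothPeriodic L (fun _ : Fin n → ℝ => c) :=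
  ⟨contDiff_const, fun _ _ => rfl⟩

lemma coef_sub {f g : (Fin n → ℝ) → ℝ} (hf : Continuous f) (hg : Continuous g)
    (k : Fin n → ℤ) : coef L (fun x => f x - g x) k = coef L f k - coef L g k := by
  unfold coef
  rw [← mul_sub, ← integral_sub (integrableOn_wave_mul hf _) (integrableOn_wave_mul hg _)]
  simp only [Complex.ofReal_sub, mul_sub]

lemma coef_const_mul (f : (Fin n → ℝ) → ℝ) (c : ℝ) (k : Fin n → ℤ) :
    coef L (fun x => c * f x) k = c * coef L f k := by
  unfold coef
  rw [mul_left_comm, ← integral_const_mul (c : ℂ)]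
  simp only [Complex.ofReal_mul, mul_left_comm (wave _ _ _)]

lemma coef_sum {ι : Type*} {s : Finset ι} {f : ι → (Fin n → ℝ) → ℝ}
    (hf : ∀ i, Continuous (f i)) (k : Fin n → ℤ) :
    coef L (fun x => ∑ i ∈ s, f i x) k = ∑ i ∈ s, coef L (f i) k := by
  unfold coef
  rw [← Finset.mul_sum, ← integral_finsetSum _ fun i _ => integrableOn_wave_mul (hf i) _]
  simp only [Complex.ofReal_sum, Finset.mul_sum]

lemma norm_coef_le (hL : 0 < L) {f : (Fin n → ℝ) → ℝ} (k : Fin n → ℤ) :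
    ‖coef L f k‖ ≤ (L ^ n)⁻¹ * ∫ x in cube n L, |f x| := by
  unfold coef
  rw [norm_mul, norm_inv, norm_pow, Complex.norm_real, Real.norm_of_nonneg hL.le]
  refine mul_le_mul_of_nonneg_left ?_ (by positivity)
  refine (norm_integral_le_integral_norm _).trans_eq ?_
  simp [norm_wave]

/-! ### Fourier multipliers -/

/-- `T` preserves smooth periodic functions and acts on Fourier coefficients as multiplication
by `M`. -/
def IsMultiplier (L : ℝ) (T : ((Fin n → ℝ) → ℝ) → ((Fin n → ℝ) → ℝ)) (M : (Fin n → ℤ) → ℂ) :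
    Prop :=
  ∀ f, SmoothPeriodic L f → SmoothPeriodic L (T f) ∧ ∀ k, coef L (T f) k = M k * coef L f k

lemma isMultiplier_pd (hL : 0 < L) (i : Fin n) :
    IsMultiplier L (pd i) (fun k => Complex.I * freq L k i) :=
  fun _ hf => ⟨hf.pd i, coef_pd hL hf i⟩

lemma IsMultiplier.iterate {T : ((Fin n → ℝ) → ℝ) → ((Fin n → ℝ) → ℝ)} {M : (Fin n → ℤ) → ℂ}
    (hT : IsMultiplier L T M) (r : ℕ) : IsMultiplier L (T^[r]) (fun k => M k ^ r) := by
  induction r with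
  | zero => exact fun f hf => ⟨hf, fun k => by simp⟩
  | succ r ih =>
    intro f hf
    rw [Function.iterate_succ_apply']
    obtain ⟨h1, h2⟩ := ih f hf
    refine ⟨(hT _ h1).1, fun k => ?_⟩
    rw [(hT _ h1).2, h2]
    ring

lemma isMultiplier_foldr_ofFn {p : ℕ} {T : Fin p → ((Fin n → ℝ) → ℝ) → ((Fin n → ℝ) → ℝ)}
    {M : Fin p → (Fin n → ℤ) → ℂ} (hT : ∀ i, IsMultiplier L (T i) (M i)) :
    IsMultiplier L (fun f => (List.ofFn T).foldr (fun d h => d h) f)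
      (fun k => ∏ i, M i k) := by
  induction p with
  | zero => exact fun f hf => ⟨by simpa using hf, fun k => by simp⟩
  | succ p ih =>
    intro f hf
    obtain ⟨h1, h2⟩ := ih (fun i => hT i.succ) f hf
    simp only [List.ofFn_succ, List.foldr_cons, Fin.prod_univ_succ]
    refine ⟨(hT 0 _ h1).1, fun k => ?_⟩
    rw [(hT 0 _ h1).2, h2]
    ring

lemma isMultiplier_pdPow (hL : 0 < L) (μ : Fin n → ℕ) :
    IsMultiplier L (pdPow μ) (fun k => ∏ i, (Complex.I * freq L k i) ^ μ i) :=
  isMultiplier_foldr_ofFn fun i => (isMultiplier_pd hL i).iterate (μ i)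

/-! ### Comparison with Fourier series on the unit torus -/

noncomputable local instance : MeasureSpace UnitAddCircle := ⟨AddCircle.haarAddCircle⟩

local instance : IsProbabilityMeasure (volume : Measure UnitAddCircle) :=
  inferInstanceAs (IsProbabilityMeasure AddCircle.haarAddCircle)

/-- A continuous periodic function, rescaled to period one, descends to the unit torus. -/
lemma exists_lift {f : (Fin n → ℝ) → ℝ} (hf : Continuous f) (hp : IsPeriodic L f) :
    ∃ F : C(UnitAddTorus (Fin n), ℂ), ∀ y : Fin n → ℝ, F (fun i => (y i : UnitAddCircle)) =
      f (L • y) := by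
  let q : C(Fin n → ℝ, UnitAddTorus (Fin n)) :=
    ⟨Pi.map (fun (_ : Fin n) (t : ℝ) => (t : UnitAddCircle)),
      Continuous.piMap fun _ => AddCircle.continuous_mk' 1⟩
  have hq : IsOpenQuotientMap q :=
    IsOpenQuotientMap.piMap fun _ => QuotientAddGroup.isOpenQuotientMap_mk
  let g : C(Fin n → ℝ, ℂ) := ⟨fun y => f (L • y), by fun_prop⟩
  have hg : Function.FactorsThrough g q := by
    intro a b hab
    have h1 : ∀ i, ∃ l : ℤ, a i = b i + l := by
      intro i
      have h2 := congrFun hab i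
      simp only [q, ContinuousMap.coe_mk, Pi.map_apply] at h2
      obtain ⟨l, hl⟩ := (QuotientAddGroup.eq_iff_sub_mem.1 h2)
      exact ⟨l, by simp at hl; linarith⟩
    choose l hl using h1
    have h3 : L • a = L • b + fun i => L * (l i : ℝ) := by
      ext i
      simp [hl i]
      ring
    simp only [g, ContinuousMap.coe_mk, h3, hp (L • b) l]
  refine ⟨hq.isQuotientMap.lift g hg, fun y => ?_⟩
  exact congrArg (fun h : C(Fin n → ℝ, ℂ) => h y) (hq.isQuotientMap.lift_comp g hg)

lemma integral_unit_box {E : Type*} [NormedAddCommGroup E] [NormedSpace ℝ E] (hL : 0 < L)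
    (g : (Fin n → ℝ) → E) :
    ∫ y in {x : Fin n → ℝ | ∀ i, x i ∈ Set.Ioc (-(1 / 2) : ℝ) (-(1 / 2) + 1)}, g (L • y) =
      (L ^ n)⁻¹ • ∫ x in cube n L, g x := by
  rw [Measure.setIntegral_comp_smul_of_pos _ _ _ hL]
  have h : L • {x : Fin n → ℝ | ∀ i, x i ∈ Set.Ioc (-(1 / 2) : ℝ) (-(1 / 2) + 1)} =
      Set.univ.pi fun _ => Set.Ioc (-L / 2) (L / 2) := by
    ext x
    rw [Set.mem_smul_set_iff_inv_smul_mem₀ hL.ne']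
    simp only [Set.mem_ofPred_eq, Set.mem_pi, Set.mem_univ, true_implies, Pi.smul_apply,
      smul_eq_mul, Set.mem_Ioc]
    refine forall_congr' fun i => ?_
    rw [lt_inv_mul_iff₀ hL, inv_mul_le_iff₀ hL]
    constructor <;> rintro ⟨h1, h2⟩ <;> constructor <;> linarith
  rw [h]
  simp only [Module.finrank_fintype_fun_eq_card, Fintype.card_fin]
  congr 1
  rw [volume_pi]
  exact setIntegral_congr_set Measure.univ_pi_Ioc_ae_eq_Icc

lemma mFourier_eq_wave (hL : 0 < L) (k : Fin n → ℤ) (y : Fin n → ℝ) :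
    UnitAddTorus.mFourier k (fun i => (y i : UnitAddCircle)) = wave L k (L • y) := by
  simp only [UnitAddTorus.mFourier, ContinuousMap.coe_mk, fourier_coe_apply, wave, phase_apply,
    freq]
  rw [← Complex.exp_sum]
  congr 1
  push_cast
  rw [Finset.sum_mul]
  refine Finset.sum_congr rfl fun i _ => ?_
  have : (L : ℂ) ≠ 0 := by exact_mod_cast hL.ne'
  simp
  field_simp

lemma mFourierCoeff_eq_coef (hL : 0 < L) {f : (Fin n → ℝ) → ℝ}
    {F : C(UnitAddTorus (Fin n), ℂ)}
    (hF : ∀ y : Fin n → ℝ, F (fun i => (y i : UnitAddCircle)) = f (L • y)) (k : Fin n → ℤ) :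
    UnitAddTorus.mFourierCoeff F k = coef L f k := by
  rw [UnitAddTorus.mFourierCoeff_eq_integral _ _ (fun _ => -(1 / 2))]
  simp only [hF, mFourier_eq_wave hL]
  rw [integral_unit_box hL (fun x => wave L (-k) x • (f x : ℂ))]
  simp [coef]

/-- **Parseval's identity** on the torus of period `L`. -/
lemma hasSum_sq_coef (hL : 0 < L) {f : (Fin n → ℝ) → ℝ} (hf : Continuous f)
    (hp : IsPeriodic L f) :
    HasSum (fun k => ‖coef L f k‖ ^ 2) ((L ^ n)⁻¹ * ∫ x in cube n L, f x ^ 2) := by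
  obtain ⟨F, hF⟩ := exists_lift hf hp
  have h := UnitAddTorus.hasSum_sq_mFourierCoeff (F.toLp 2 volume ℂ)
  simp only [UnitAddTorus.mFourierCoeff_toLp, mFourierCoeff_eq_coef hL hF] at h
  have h2 : ∫ t, ‖F.toLp 2 volume ℂ t‖ ^ 2 = ∫ t, ‖F t‖ ^ 2 := by
    refine integral_congr_ae ?_
    filter_upwards [F.coeFn_toLp (p := 2) (𝕜 := ℂ) volume] with t ht
    rw [ht]
  rw [h2, UnitAddTorus.integral_preimage _ (fun _ => -(1 / 2))] at h
  simp only [hF] at h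
  rw [integral_unit_box hL (fun x => ‖(f x : ℂ)‖ ^ 2)] at h
  simpa using h

/-- Fourier inversion on the torus of period `L`. -/
lemma hasSum_coef_mul_wave (hL : 0 < L) {f : (Fin n → ℝ) → ℝ} (hf : Continuous f)
    (hp : IsPeriodic L f) (hs : Summable (coef L f)) (x : Fin n → ℝ) :
    HasSum (fun k => coef L f k * wave L k x) (f x) := by
  obtain ⟨F, hF⟩ := exists_lift hf hp
  have h1 : UnitAddTorus.mFourierCoeff F = coef L f := funext (mFourierCoeff_eq_coef hL hF)
  have h := UnitAddTorus.hasSum_mFourier_series_apply_of_summable (h1 ▸ hs)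
    (fun i => ((L⁻¹ • x) i : UnitAddCircle))
  simpa only [h1, hF, mFourier_eq_wave hL, smul_inv_smul₀ hL.ne', smul_eq_mul] using h

/-! ### Rapidly decreasing coefficients -/

/-- The weight `1 + |k|²` on `ℤⁿ`. -/
def weight (k : Fin n → ℤ) : ℝ := 1 + ∑ i, (k i : ℝ) ^ 2

lemma one_le_weight (k : Fin n → ℤ) : 1 ≤ weight k :=
  le_add_of_nonneg_right (Finset.sum_nonneg fun _ _ => sq_nonneg _)

lemma weight_pos (k : Fin n → ℤ) : 0 < weight k := zero_lt_one.trans_le (one_le_weight k)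

lemma one_add_sq_le_weight (k : Fin n → ℤ) (i : Fin n) : 1 + (k i : ℝ) ^ 2 ≤ weight k :=
  add_le_add_right
    (Finset.single_le_sum (f := fun i => (k i : ℝ) ^ 2) (fun _ _ => sq_nonneg _)
      (Finset.mem_univ i)) 1

lemma abs_le_weight (k : Fin n → ℤ) (i : Fin n) : |(k i : ℝ)| ≤ weight k := by
  refine le_trans ?_ (one_add_sq_le_weight k i)
  rw [← sq_abs]
  nlinarith [sq_nonneg (|(k i : ℝ)| - 1), abs_nonneg (k i : ℝ)]

lemma summable_inv_one_add_sq_int : Summable fun a : ℤ => (1 + (a : ℝ) ^ 2)⁻¹ := by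
  have h1 : Summable fun a : ℤ => 1 / (a : ℝ) ^ 2 := Real.summable_one_div_int_pow.2 one_lt_two
  have h2 : Summable fun a : ℤ => if a = 0 then (1 : ℝ) else 0 := (hasSum_ite_eq 0 1).summable
  refine Summable.of_nonneg_of_le (fun a => by positivity) (fun a => ?_) (h1.add h2)
  by_cases ha : a = 0
  · simp [ha]
  · have : (0 : ℝ) < (a : ℝ) ^ 2 := by positivity
    simp only [ha, if_false, add_zero, one_div]
    exact inv_anti₀ this (by linarith)

lemma summable_inv_weight_pow : Summable fun k : Fin n → ℤ => (weight k ^ n)⁻¹ := by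
  set g : ℤ → ℝ := fun a => (1 + (a : ℝ) ^ 2)⁻¹ with hg
  have hg0 : ∀ a, 0 ≤ g a := fun a => by positivity
  have hprod : Summable fun k : Fin n → ℤ => ∏ i, g (k i) := by
    refine summable_of_sum_le (c := ∏ _i : Fin n, ∑' a, g a)
      (fun k => Finset.prod_nonneg fun i _ => hg0 _) fun s => ?_
    classical
    calc ∑ k ∈ s, ∏ i, g (k i)
        ≤ ∑ k ∈ Fintype.piFinset fun i => s.image (fun k => k i), ∏ i, g (k i) := by
          refine Finset.sum_le_sum_of_subset_of_nonneg (fun k hk => ?_)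
            fun k _ _ => Finset.prod_nonneg fun i _ => hg0 _
          exact Fintype.mem_piFinset.2 fun i => Finset.mem_image_of_mem _ hk
      _ = ∏ i, ∑ a ∈ s.image (fun k => k i), g a := (Finset.prod_univ_sum _ _).symm
      _ ≤ ∏ _i : Fin n, ∑' a, g a :=
          Finset.prod_le_prod (fun i _ => Finset.sum_nonneg fun a _ => hg0 a)
            fun i _ => summable_inv_one_add_sq_int.sum_le_tsum _ fun a _ => hg0 a
  refine Summable.of_nonneg_of_le (fun k => by have := weight_pos k; positivity) (fun k => ?_)
    hprod
  simp only [hg, Finset.prod_inv_distrib]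
  refine inv_anti₀ (Finset.prod_pos fun i _ => by positivity) ?_
  calc ∏ i, (1 + (k i : ℝ) ^ 2) ≤ ∏ _i : Fin n, weight k :=
        Finset.prod_le_prod (fun i _ => by positivity) fun i _ => one_add_sq_le_weight k i
    _ = weight k ^ n := by simp

/-- Families on `ℤⁿ` decreasing faster than any power. -/
def IsRapid (c : (Fin n → ℤ) → ℂ) : Prop := ∀ N : ℕ, Summable fun k => weight k ^ N * ‖c k‖

lemma IsRapid.of_le {c d : (Fin n → ℤ) → ℂ} (hc : IsRapid c) (K : ℝ)
    (h : ∀ k, ‖d k‖ ≤ K * weight k * ‖c k‖) : IsRapid d := by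
  intro N
  have hw := fun k : Fin n → ℤ => weight_pos k
  refine Summable.of_nonneg_of_le (fun k => by have := hw k; positivity) (fun k => ?_)
    ((hc (N + 1)).mul_left K)
  calc weight k ^ N * ‖d k‖ ≤ weight k ^ N * (K * weight k * ‖c k‖) :=
        mul_le_mul_of_nonneg_left (h k) (pow_nonneg (hw k).le _)
    _ = K * (weight k ^ (N + 1) * ‖c k‖) := by ring

lemma IsRapid.sum {ι : Type*} {s : Finset ι} {c : ι → (Fin n → ℤ) → ℂ}
    (hc : ∀ i, IsRapid (c i)) : IsRapid fun k => ∑ i ∈ s, c i k := by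
  intro N
  refine Summable.of_nonneg_of_le (fun k => by have := weight_pos k; positivity) (fun k => ?_)
    (summable_sum (s := s) fun i _ => hc i N)
  rw [← Finset.mul_sum]
  exact mul_le_mul_of_nonneg_left (norm_sum_le _ _) (pow_nonneg (weight_pos k).le _)

lemma IsRapid.summable_norm {c : (Fin n → ℤ) → ℂ} (hc : IsRapid c) :
    Summable fun k => ‖c k‖ := by
  simpa using hc 0

lemma abs_freq_le (hL : 0 < L) (k : Fin n → ℤ) (i : Fin n) :
    |freq L k i| ≤ 2 * Real.pi / L * weight k := by
  unfold freq
  have h : 0 ≤ 2 * Real.pi / L := by positivity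
  rw [abs_mul, abs_of_nonneg h]
  exact mul_le_mul_of_nonneg_left (abs_le_weight k i) h

lemma IsRapid.freq_mul (hL : 0 < L) {c : (Fin n → ℤ) → ℂ} (hc : IsRapid c) (i : Fin n) :
    IsRapid fun k => Complex.I * freq L k i * c k := by
  refine hc.of_le (2 * Real.pi / L) fun k => ?_
  rw [norm_mul, norm_mul, Complex.norm_I, one_mul, Complex.norm_real, Real.norm_eq_abs]
  exact mul_le_mul_of_nonneg_right (abs_freq_le hL k i) (norm_nonneg _)

lemma isMultiplier_weight (hL : 0 < L) :
    IsMultiplier (n := n) L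
      (fun f x => f x - (L / (2 * Real.pi)) ^ 2 * ∑ i, pd i (pd i f) x)
      (fun k => (weight k : ℂ)) := by
  intro f hf
  have h2 : ∀ i, SmoothPeriodic L (pd i (pd i f)) := fun i => (hf.pd i).pd i
  have h3 : SmoothPeriodic L fun x => ∑ i, pd i (pd i f) x := SmoothPeriodic.sum h2
  have h4 := h3.const_mul ((L / (2 * Real.pi)) ^ 2)
  refine ⟨hf.sub h4, fun k => ?_⟩
  rw [coef_sub hf.contDiff.continuous h4.contDiff.continuous, coef_const_mul,
    coef_sum fun i => (h2 i).contDiff.continuous]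
  simp only [coef_pd hL (hf.pd _), coef_pd hL hf]
  unfold weight freq
  push_cast
  rw [add_mul, one_mul, Finset.sum_mul, Finset.mul_sum, sub_eq_add_neg, ← Finset.sum_neg_distrib]
  congr 1
  refine Finset.sum_congr rfl fun i _ => ?_
  have h5 : (L : ℂ) ≠ 0 := by exact_mod_cast hL.ne'
  have h6 : (Real.pi : ℂ) ≠ 0 := by exact_mod_cast Real.pi_ne_zero
  field_simp
  rw [Complex.I_sq]
  ring

/-- The Fourier coefficients of a smooth periodic function decrease rapidly. -/
lemma SmoothPeriodic.isRapid_coef (hL : 0 < L) {f : (Fin n → ℝ) → ℝ}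
    (hf : SmoothPeriodic L f) : IsRapid (coef L f) := by
  intro N
  obtain ⟨-, h2⟩ := (isMultiplier_weight hL).iterate (N + n) f hf
  set g := (fun (f : (Fin n → ℝ) → ℝ) x =>
    f x - (L / (2 * Real.pi)) ^ 2 * ∑ i, _root_.pd i (_root_.pd i f) x)^[N + n] f
  refine Summable.of_nonneg_of_le (fun k => by have := weight_pos k; positivity) (fun k => ?_)
    (summable_inv_weight_pow.mul_left ((L ^ n)⁻¹ * ∫ x in cube n L, |g x|))
  have hw := weight_pos k
  have h3 : ‖coef L g k‖ = weight k ^ (N + n) * ‖coef L f k‖ := by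
    rw [h2, norm_mul, norm_pow, Complex.norm_real, Real.norm_of_nonneg hw.le]
  rw [← div_eq_mul_inv, le_div_iff₀ (by positivity)]
  calc weight k ^ N * ‖coef L f k‖ * weight k ^ n = ‖coef L g k‖ := by rw [h3, pow_add]; ring
    _ ≤ _ := norm_coef_le hL k

/-! ### Synthesis of smooth functions from their coefficients -/

/-- The real part of the Fourier series with coefficients `c`. -/
noncomputable def synth (L : ℝ) (c : (Fin n → ℤ) → ℂ) (x : Fin n → ℝ) : ℝ :=
  (∑' k, c k * wave L k x).re

lemma iteratedDeriv_const_mul_exp_I (a : ℂ) (j : ℕ) :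
    iteratedDeriv j (fun t : ℝ => a * Complex.exp (t * Complex.I)) =
      fun t : ℝ => a * Complex.I ^ j * Complex.exp (t * Complex.I) := by
  induction j with
  | zero => simp
  | succ j ih =>
    rw [iteratedDeriv_succ, ih]
    ext t
    have h1 : HasDerivAt (fun t : ℝ => (t : ℂ) * Complex.I) Complex.I t := by
      simpa using (Complex.ofRealCLM.hasDerivAt (x := t)).mul_const Complex.I
    rw [(h1.cexp.const_mul (a * Complex.I ^ j)).deriv]
    ring

lemma norm_phase_le (hL : 0 < L) (k : Fin n → ℤ) :
    ‖phase L k‖ ≤ n * (2 * Real.pi / L) * weight k := by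
  have hw := weight_pos k
  refine ContinuousLinearMap.opNorm_le_bound _ (by positivity) fun x => ?_
  rw [phase_apply]
  calc ‖∑ i, freq L k i * x i‖ ≤ ∑ i, ‖freq L k i * x i‖ := norm_sum_le _ _
    _ ≤ ∑ _i : Fin n, 2 * Real.pi / L * weight k * ‖x‖ := by
        refine Finset.sum_le_sum fun i _ => ?_
        rw [norm_mul]
        exact mul_le_mul (abs_freq_le hL k i) (norm_le_pi_norm x i) (norm_nonneg _)
          (by positivity)
    _ = n * (2 * Real.pi / L) * weight k * ‖x‖ := by
        simp
        ring

lemma norm_iteratedFDeriv_wave_le (hL : 0 < L) (a : ℂ) (k : Fin n → ℤ) (j : ℕ)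
    (x : Fin n → ℝ) :
    ‖iteratedFDeriv ℝ j (fun x => a * wave L k x) x‖ ≤
      (n * (2 * Real.pi / L)) ^ j * (weight k ^ j * ‖a‖) := by
  set h : ℝ → ℂ := fun t => a * Complex.exp (t * Complex.I) with hh
  have hs : ContDiff ℝ ∞ h := by
    have : ContDiff ℝ ∞ (fun t : ℝ => (t : ℂ)) := Complex.ofRealCLM.contDiff
    fun_prop
  have h1 : (fun x => a * wave L k x) = h ∘ phase L k := rfl
  rw [h1, (phase L k).iteratedFDeriv_comp_right hs x (i := j) (by exact_mod_cast le_top)]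
  refine (ContinuousMultilinearMap.norm_compContinuousLinearMap_le _ _).trans ?_
  rw [norm_iteratedFDeriv_eq_norm_iteratedDeriv, hh, iteratedDeriv_const_mul_exp_I]
  simp only [norm_mul, norm_pow, Complex.norm_I, one_pow, mul_one, Complex.norm_exp_ofReal_mul_I,
    Finset.prod_const, Finset.card_univ, Fintype.card_fin]
  calc ‖a‖ * ‖phase L k‖ ^ j ≤ ‖a‖ * (n * (2 * Real.pi / L) * weight k) ^ j := by
        gcongr
        exact norm_phase_le hL k
    _ = _ := by ring

lemma smoothPeriodic_synth (hL : 0 < L) {c : (Fin n → ℤ) → ℂ} (hc : IsRapid c) :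
    SmoothPeriodic L (synth L c) := by
  constructor
  · have h : ContDiff ℝ ∞ fun x => ∑' k, c k * wave L k x :=
      contDiff_tsum (fun k => contDiff_const.mul (contDiff_wave k))
        (fun j _ => (hc j).mul_left _)
        (fun j k x _ => norm_iteratedFDeriv_wave_le hL (c k) k j x)
    exact Complex.reCLM.contDiff.comp h
  · intro x l
    simp only [synth, wave_periodic hL.ne' _ x l]

lemma IsRapid.summable_mul_wave {c : (Fin n → ℤ) → ℂ} (hc : IsRapid c) (x : Fin n → ℝ) :
    Summable fun k => c k * wave L k x :=
  Summable.of_norm (by simpa [norm_wave] using hc.summable_norm)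

lemma hasDerivAt_wave_update (k : Fin n → ℤ) (i : Fin n) (x : Fin n → ℝ) (t : ℝ) :
    HasDerivAt (fun t => wave L k (Function.update x i t))
      (Complex.I * freq L k i * wave L k (Function.update x i t)) t := by
  have h := (hasFDerivAt_wave (L := L) k (Function.update x i t)).comp_hasDerivAt t
    (hasDerivAt_update x i t)
  rw [← (hasFDerivAt_wave (L := L) k (Function.update x i t)).fderiv, fderiv_wave_single] at h
  exact h

lemma pd_synth (hL : 0 < L) {c : (Fin n → ℤ) → ℂ} (hc : IsRapid c) (i : Fin n)
    (x : Fin n → ℝ) :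
    pd i (synth L c) x = synth L (fun k => Complex.I * freq L k i * c k) x := by
  have h := hasDerivAt_tsum (𝕜 := ℝ) (y₀ := x i)
    (g := fun k t => c k * wave L k (Function.update x i t))
    (g' := fun k t => Complex.I * freq L k i * c k * wave L k (Function.update x i t))
    (hc.freq_mul hL i).summable_norm
    (fun k t => by
      convert! (hasDerivAt_wave_update (L := L) k i x t).const_mul (c k) using 1
      ring)
    (fun k t => by rw [norm_mul, norm_wave, mul_one])
    (hc.summable_mul_wave _) (x i)
  have h2 := (Complex.reCLM.hasFDerivAt.comp_hasDerivAt (x i) h).deriv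
  simp only [Function.update_eq_self] at h2
  exact h2

lemma synth_coef (hL : 0 < L) {f : (Fin n → ℝ) → ℝ} (hf : SmoothPeriodic L f)
    (x : Fin n → ℝ) : synth L (coef L f) x = f x := by
  rw [synth, (hasSum_coef_mul_wave hL hf.contDiff.continuous hf.periodic
    (hf.isRapid_coef hL).summable_norm.of_norm x).tsum_eq, Complex.ofReal_re]

lemma synth_sub {c d : (Fin n → ℤ) → ℂ} (hc : IsRapid c) (hd : IsRapid d) (x : Fin n → ℝ) :
    synth L (fun k => c k - d k) x = synth L c x - synth L d x := by
  simp only [synth, sub_mul]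
  rw [(hc.summable_mul_wave x).tsum_sub (hd.summable_mul_wave x), Complex.sub_re]

lemma synth_sum {ι : Type*} {s : Finset ι} {c : ι → (Fin n → ℤ) → ℂ}
    (hc : ∀ i, IsRapid (c i)) (x : Fin n → ℝ) :
    synth L (fun k => ∑ i ∈ s, c i k) x = ∑ i ∈ s, synth L (c i) x := by
  simp only [synth, Finset.sum_mul]
  rw [Summable.tsum_finsetSum fun i _ => (hc i).summable_mul_wave x, Complex.re_sum]

/-! ### Closed two-forms and their potentials -/

section Potential

variable {B : Fin n → Fin n → (Fin n → ℝ) → ℝ}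

lemma _root_.GoodB.smoothPeriodic (hB : GoodB n L B) (i j : Fin n) : SmoothPeriodic L (B i j) :=
  ⟨hB.1 i j, hB.2.1 i j⟩

lemma _root_.GoodB.eq_zero_of_mem_face (hL : 2 < L) (hB : GoodB n L B) (i j l : Fin n)
    {x : Fin n → ℝ} (hx : x ∈ cube n L) (hl : x l ^ 2 = (L / 2) ^ 2) : B i j x = 0 := by
  refine hB.2.2.2.2 i j x hx ?_
  calc (1 : ℝ) ≤ x l ^ 2 := by rw [hl]; nlinarith
    _ ≤ ∑ l, x l ^ 2 := Finset.single_le_sum (f := fun l => x l ^ 2)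
        (fun _ _ => sq_nonneg _) (Finset.mem_univ l)

lemma update_mem_cube {x : Fin n → ℝ} (hx : x ∈ cube n L) (l : Fin n) {t : ℝ}
    (ht : t ∈ Set.Icc (-L / 2) (L / 2)) : Function.update x l t ∈ cube n L := by
  constructor <;> intro j <;> by_cases h : j = l
  · subst h; simpa using ht.1
  · simpa [h] using hx.1 j
  · subst h; simpa using ht.2
  · simpa [h] using hx.2 j

lemma _root_.GoodB.integral_coord_mul_pd (hL : 2 < L) (hB : GoodB n L B) (i j k l : Fin n) :
    ∫ x in cube n L, (x k * pd l (B i j) x + (if l = k then B i j x else 0)) = 0 := by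
  have hf := hB.smoothPeriodic i j
  have hG : ContDiff ℝ ∞ fun x : Fin n → ℝ => ((x k * B i j x : ℝ) : ℂ) :=
    Complex.ofRealCLM.contDiff.comp ((contDiff_apply ℝ ℝ k).mul hf.contDiff)
  have h := integral_fderiv_single_eq_zero (L := L) (by linarith) hG l fun x hx => by
    rw [hB.eq_zero_of_mem_face hL i j l
        (update_mem_cube hx l (t := L / 2) ⟨by linarith, le_rfl⟩) (by simp),
      hB.eq_zero_of_mem_face hL i j l
        (update_mem_cube hx l (t := -L / 2) ⟨le_rfl, by linarith⟩) (by simp; ring)]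
    simp
  have hder : ∀ x, fderiv ℝ (fun x : Fin n → ℝ => ((x k * B i j x : ℝ) : ℂ)) x
      (Pi.single l 1) =
      ((x k * pd l (B i j) x + (if l = k then B i j x else 0) : ℝ) : ℂ) := by
    intro x
    have h1 : HasFDerivAt (fun x : Fin n → ℝ => ((x k * B i j x : ℝ) : ℂ)) _ x :=
      Complex.ofRealCLM.hasFDerivAt.comp x
        ((ContinuousLinearMap.proj (R := ℝ) (φ := fun _ : Fin n => ℝ) k).hasFDerivAt.fun_mul
          (hf.differentiable x).hasFDerivAt)
    rw [h1.fderiv, pd_eq_fderiv hf.differentiable]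
    by_cases hkl : l = k
    · subst hkl; simp
    · simp [hkl, Ne.symm hkl]
  simp only [hder] at h
  rw [integral_complex_ofReal] at h
  exact_mod_cast h

lemma coef_zero (f : (Fin n → ℝ) → ℝ) :
    coef L f 0 = (((L ^ n)⁻¹ * ∫ x in cube n L, f x : ℝ) : ℂ) := by
  unfold coef
  simp only [wave, phase_apply, neg_zero, freq_zero, zero_mul, Finset.sum_const_zero,
    Complex.ofReal_zero, Complex.exp_zero, one_mul]
  rw [integral_complex_ofReal]
  push_cast
  rfl

/-- The components of a compactly supported closed two-form have mean zero. -/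
lemma _root_.GoodB.coef_zero_eq_zero (hn : 3 ≤ n) (hL : 2 < L) (hB : GoodB n L B) (i j : Fin n) :
    coef L (B i j) 0 = 0 := by
  obtain ⟨k, hk⟩ : ∃ k, k ∉ ({i, j} : Finset (Fin n)) := by
    by_contra! h
    have h1 := Finset.card_le_card fun k (_ : k ∈ Finset.univ) => h k
    have h2 := Finset.card_le_two (a := i) (b := j)
    rw [Finset.card_univ, Fintype.card_fin] at h1
    omega
  have hki : i ≠ k := fun h => hk (by simp [h])
  have hkj : j ≠ k := fun h => hk (by simp [h])
  have h_int : ∀ a b l : Fin n,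
      IntegrableOn (fun x => x k * pd l (B a b) x + (if l = k then B a b x else 0))
        (cube n L) := by
    intro a b l
    have h1 := ((hB.smoothPeriodic a b).pd l).contDiff.continuous
    have h2 := (hB.smoothPeriodic a b).contDiff.continuous
    have h3 : Continuous fun x => x k * pd l (B a b) x + (if l = k then B a b x else 0) := by
      split_ifs <;> fun_prop
    exact h3.continuousOn.integrableOn_compact isCompact_Icc
  have h1 := hB.integral_coord_mul_pd hL i j k k
  have h2 := hB.integral_coord_mul_pd hL j k k i
  have h3 := hB.integral_coord_mul_pd hL k i k j
  have h4 : ∀ x : Fin n → ℝ, B i j x =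
      (x k * pd k (B i j) x + (if k = k then B i j x else 0)) +
      (x k * pd i (B j k) x + (if i = k then B j k x else 0)) +
      (x k * pd j (B k i) x + (if j = k then B k i x else 0)) := by
    intro x
    simp only [hki, hkj, if_true, if_false]
    linear_combination -x k * hB.2.2.2.1 i j k x
  rw [coef_zero, integral_congr_ae (Filter.Eventually.of_forall h4),
    integral_add (by exact (h_int i j k).add (h_int j k i)) (h_int k i j),
    integral_add (h_int i j k) (h_int j k i), h1, h2, h3]
  simp

lemma _root_.GoodB.coef_antisymm (hB : GoodB n L B) (i j : Fin n) (k : Fin n → ℤ) :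
    coef L (B i j) k = -coef L (B j i) k := by
  have h : B i j = fun x => (-1) * B j i x := by
    funext x
    rw [hB.2.2.1 i j x]
    ring
  rw [h, coef_const_mul]
  simp

lemma _root_.GoodB.coef_closed (hL : 0 < L) (hB : GoodB n L B) (i j l : Fin n) (k : Fin n → ℤ) :
    (freq L k l : ℂ) * coef L (B i j) k + freq L k i * coef L (B j l) k +
      freq L k j * coef L (B l i) k = 0 := by
  have h1 : pd l (B i j) = fun x => (-1) * pd i (B j l) x - pd j (B l i) x := by
    funext x
    linarith [hB.2.2.2.1 i j l x]
  have h2 := coef_pd hL (hB.smoothPeriodic i j) l k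
  rw [h1, coef_sub (((hB.smoothPeriodic j l).pd i).const_mul _).contDiff.continuous
    ((hB.smoothPeriodic l i).pd j).contDiff.continuous, coef_const_mul,
    coef_pd hL (hB.smoothPeriodic j l), coef_pd hL (hB.smoothPeriodic l i)] at h2
  push_cast at h2
  refine mul_left_cancel₀ Complex.I_ne_zero ?_
  linear_combination -h2

/-- The squared length of the frequency vector. -/
noncomputable def freqSq (L : ℝ) (k : Fin n → ℤ) : ℝ := ∑ i, freq L k i ^ 2

lemma freqSq_nonneg (k : Fin n → ℤ) : 0 ≤ freqSq L k :=
  Finset.sum_nonneg fun _ _ => sq_nonneg _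

lemma sq_freq_le_freqSq (k : Fin n → ℤ) (i : Fin n) : freq L k i ^ 2 ≤ freqSq L k :=
  Finset.single_le_sum (f := fun i => freq L k i ^ 2) (fun _ _ => sq_nonneg _)
    (Finset.mem_univ i)

lemma freqSq_pos (hL : 0 < L) {k : Fin n → ℤ} (hk : k ≠ 0) : 0 < freqSq L k := by
  obtain ⟨i, hi⟩ := Function.ne_iff.1 hk
  refine lt_of_lt_of_le ?_ (sq_freq_le_freqSq k i)
  have h1 : (k i : ℝ) ≠ 0 := by exact_mod_cast hi
  unfold freq
  positivity

lemma abs_freq_le_freqSq (hL : 0 < L) (k : Fin n → ℤ) (i : Fin n) :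
    |freq L k i| ≤ L / (2 * Real.pi) * freqSq L k := by
  have h0 : |(k i : ℝ)| ≤ (k i : ℝ) ^ 2 := by
    rw [← sq_abs]
    by_cases h : k i = 0
    · simp [h]
    · have : (1 : ℝ) ≤ |(k i : ℝ)| := by exact_mod_cast Int.one_le_abs h
      nlinarith
  calc |freq L k i| = 2 * Real.pi / L * |(k i : ℝ)| := by
        rw [freq, abs_mul, abs_of_nonneg (by positivity)]
    _ ≤ 2 * Real.pi / L * (k i : ℝ) ^ 2 := mul_le_mul_of_nonneg_left h0 (by positivity)
    _ = L / (2 * Real.pi) * freq L k i ^ 2 := by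
        unfold freq
        have := Real.pi_pos
        field_simp
    _ ≤ _ := mul_le_mul_of_nonneg_left (sq_freq_le_freqSq k i) (by positivity)

lemma ofReal_freqSq (k : Fin n → ℤ) :
    ((freqSq L k : ℝ) : ℂ) = ∑ i, (freq L k i : ℂ) ^ 2 := by
  simp [freqSq]

/-- The Fourier coefficients of `Σᵢ ∂ᵢ Δ⁻¹ Bᵢⱼ`. -/
noncomputable def potentialCoef (L : ℝ) (B : Fin n → Fin n → (Fin n → ℝ) → ℝ) (j : Fin n)
    (k : Fin n → ℤ) : ℂ :=
  ∑ i, -(Complex.I * freq L k i) / freqSq L k * coef L (B i j) k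

lemma _root_.GoodB.isRapid_potentialCoef (hL : 0 < L) (hB : GoodB n L B) (j : Fin n) :
    IsRapid (potentialCoef L B j) := by
  refine IsRapid.sum fun i => ?_
  refine ((hB.smoothPeriodic i j).isRapid_coef hL).of_le (L / (2 * Real.pi)) fun k => ?_
  rw [norm_mul]
  refine mul_le_mul_of_nonneg_right ?_ (norm_nonneg _)
  rw [norm_div, norm_neg, norm_mul, Complex.norm_I, one_mul, Complex.norm_real,
    Complex.norm_real, Real.norm_eq_abs, Real.norm_of_nonneg (freqSq_nonneg k)]
  refine (div_le_of_le_mul₀ (freqSq_nonneg k) (by positivity) (abs_freq_le_freqSq hL k i)).trans ?_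
  exact le_mul_of_one_le_right (by positivity) (one_le_weight k)

lemma _root_.GoodB.curl_potentialCoef (hn : 3 ≤ n) (hL : 2 < L) (hB : GoodB n L B) (i j : Fin n)
    (k : Fin n → ℤ) :
    Complex.I * freq L k i * potentialCoef L B j k -
      Complex.I * freq L k j * potentialCoef L B i k = coef L (B i j) k := by
  by_cases hk : k = 0
  · subst hk
    simp [freq_zero, hB.coef_zero_eq_zero hn hL]
  have hQ : ((freqSq L k : ℝ) : ℂ) ≠ 0 := by
    exact_mod_cast (freqSq_pos (by linarith) hk).ne'
  unfold potentialCoef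
  rw [Finset.mul_sum, Finset.mul_sum, ← Finset.sum_sub_distrib]
  calc _ = ∑ l, (freq L k l : ℂ) ^ 2 * (coef L (B i j) k / freqSq L k) := by
        refine Finset.sum_congr rfl fun l _ => ?_
        have h1 := hB.coef_closed (by linarith) i j l k
        have h2 := hB.coef_antisymm j l k
        rw [h2] at h1
        field_simp
        rw [Complex.I_sq]
        linear_combination (freq L k l : ℂ) * -h1
    _ = coef L (B i j) k := by
        rw [← Finset.sum_mul, ← ofReal_freqSq]
        field_simp

lemma _root_.GoodB.div_potentialCoef (hB : GoodB n L B) (k : Fin n → ℤ) :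
    ∑ j, Complex.I * freq L k j * potentialCoef L B j k = 0 := by
  unfold potentialCoef
  simp only [Finset.mul_sum]
  refine self_eq_neg.1 ?_
  conv_lhs => rw [Finset.sum_comm]
  simp only [← Finset.sum_neg_distrib]
  refine Finset.sum_congr rfl fun i _ => Finset.sum_congr rfl fun j _ => ?_
  rw [hB.coef_antisymm i j]
  ring

lemma pd_sub_const (f : (Fin n → ℝ) → ℝ) (c : ℝ) (i : Fin n) :
    pd i (fun x => f x - c) = pd i f := by
  funext x
  simp [pd]

lemma coef_sub_mean_zero (hL : 0 < L) {f : (Fin n → ℝ) → ℝ} (hf : Continuous f) :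
    coef L (fun x => f x - (L ^ n)⁻¹ * ∫ y in cube n L, f y) 0 = 0 := by
  rw [coef_zero]
  norm_cast
  have hc : Continuous fun _ : Fin n → ℝ => (L ^ n)⁻¹ * ∫ y in cube n L, f y :=
    continuous_const
  rw [integral_sub (hf.continuousOn.integrableOn_compact isCompact_Icc)
    (hc.continuousOn.integrableOn_compact isCompact_Icc), setIntegral_const, measureReal_def,
    Real.volume_Icc_pi_toReal (fun _ => by linarith)]
  simp only [Finset.prod_const, Finset.card_univ, Fintype.card_fin, smul_eq_mul]
  have : L / 2 - -L / 2 = L := by ring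
  rw [this]
  generalize (∫ y in cube n L, f y) = M at *
  field_simp
  simp

/-- Existence of a divergence-free, mean-zero vector potential (Coulomb gauge). -/
lemma _root_.GoodB.exists_potential (hn : 3 ≤ n) (hL : 2 < L) (hB : GoodB n L B) :
    ∃ A : Fin n → (Fin n → ℝ) → ℝ, (∀ i, SmoothPeriodic L (A i)) ∧
      (∀ i j x, pd i (A j) x - pd j (A i) x = B i j x) ∧
      (∀ x, ∑ j, pd j (A j) x = 0) ∧ ∀ i, coef L (A i) 0 = 0 := by
  have hL0 : 0 < L := by linarith
  have ha := fun j => hB.isRapid_potentialCoef hL0 j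
  have hA := fun j => smoothPeriodic_synth hL0 (ha j)
  refine ⟨fun j x => synth L (potentialCoef L B j) x -
    (L ^ n)⁻¹ * ∫ y in cube n L, synth L (potentialCoef L B j) y,
    fun j => (hA j).sub (smoothPeriodic_const _), fun i j x => ?_, fun x => ?_,
    fun j => coef_sub_mean_zero hL0 (hA j).contDiff.continuous⟩
  · rw [pd_sub_const, pd_sub_const, pd_synth hL0 (ha j), pd_synth hL0 (ha i),
      ← synth_sub ((ha j).freq_mul hL0 i) ((ha i).freq_mul hL0 j),
      ← synth_coef hL0 (hB.smoothPeriodic i j) x]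
    simp only [hB.curl_potentialCoef hn hL i j]
  · simp only [pd_sub_const, pd_synth hL0 (ha _)]
    rw [← synth_sum fun j => (ha j).freq_mul hL0 j]
    simp only [hB.div_potentialCoef]
    simp [synth]

end Potential

/-! ### The Sobolev estimate -/

section Estimate

variable {A : Fin n → (Fin n → ℝ) → ℝ} {B : Fin n → Fin n → (Fin n → ℝ) → ℝ}

/-- A mean-zero divergence-free potential is recovered from its curl on the Fourier side. -/
lemma freqSq_mul_coef (hL : 0 < L) (hA : ∀ i, SmoothPeriodic L (A i))
    (hcurl : ∀ i j x, pd i (A j) x - pd j (A i) x = B i j x)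
    (hdiv : ∀ x, ∑ j, pd j (A j) x = 0) (j : Fin n) (k : Fin n → ℤ) :
    (freqSq L k : ℂ) * coef L (A j) k =
      ∑ i, -(Complex.I * freq L k i) * coef L (B i j) k := by
  have h1 : ∑ i, Complex.I * freq L k i * coef L (A i) k = 0 := by
    have h2 : coef L (fun x => ∑ i, pd i (A i) x) k = 0 := by
      simp only [hdiv]
      simp [coef]
    rw [coef_sum fun i => ((hA i).pd i).contDiff.continuous] at h2
    rw [← h2]
    exact Finset.sum_congr rfl fun i _ => (coef_pd hL (hA i) i k).symm
  have h3 : ∀ i, coef L (B i j) k =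
      Complex.I * freq L k i * coef L (A j) k - Complex.I * freq L k j * coef L (A i) k := by
    intro i
    rw [← coef_pd hL (hA j), ← coef_pd hL (hA i),
      ← coef_sub ((hA j).pd i).contDiff.continuous ((hA i).pd j).contDiff.continuous]
    exact congrArg (fun f => coef L f k) (funext fun x => (hcurl i j x).symm)
  calc (freqSq L k : ℂ) * coef L (A j) k
      = ∑ i, (freq L k i : ℂ) ^ 2 * coef L (A j) k +
          Complex.I * freq L k j * ∑ i, Complex.I * freq L k i * coef L (A i) k := by
        rw [h1, ofReal_freqSq, Finset.sum_mul, mul_zero, add_zero]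
    _ = _ := by
        rw [Finset.mul_sum, ← Finset.sum_add_distrib]
        refine Finset.sum_congr rfl fun i _ => ?_
        rw [h3]
        linear_combination (freq L k i : ℂ) ^ 2 * coef L (A j) k * Complex.I_sq

lemma mul_norm_coef_le (hL : 0 < L) (hA : ∀ i, SmoothPeriodic L (A i))
    (hcurl : ∀ i j x, pd i (A j) x - pd j (A i) x = B i j x)
    (hdiv : ∀ x, ∑ j, pd j (A j) x = 0) (hzero : ∀ i, coef L (A i) 0 = 0) (j : Fin n)
    (k : Fin n → ℤ) {c D : ℝ} (hc : 0 ≤ c) (hD : 0 ≤ D)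
    (h : ∀ i, c * |freq L k i| ≤ D * freqSq L k) :
    c * ‖coef L (A j) k‖ ≤ D * ∑ i, ‖coef L (B i j) k‖ := by
  by_cases hk : k = 0
  · subst hk
    rw [hzero, norm_zero, mul_zero]
    positivity
  have hQ := freqSq_pos hL hk
  refine le_of_mul_le_mul_left ?_ hQ
  calc freqSq L k * (c * ‖coef L (A j) k‖) = c * ‖(freqSq L k : ℂ) * coef L (A j) k‖ := by
        rw [norm_mul, Complex.norm_of_nonneg hQ.le]
        ring
    _ ≤ c * ∑ i, |freq L k i| * ‖coef L (B i j) k‖ := by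
        rw [freqSq_mul_coef hL hA hcurl hdiv]
        refine mul_le_mul_of_nonneg_left ((norm_sum_le _ _).trans_eq ?_) hc
        simp
    _ = ∑ i, c * |freq L k i| * ‖coef L (B i j) k‖ := by simp only [Finset.mul_sum, mul_assoc]
    _ ≤ ∑ i, D * freqSq L k * ‖coef L (B i j) k‖ :=
        Finset.sum_le_sum fun i _ => mul_le_mul_of_nonneg_right (h i) (norm_nonneg _)
    _ = freqSq L k * (D * ∑ i, ‖coef L (B i j) k‖) := by
        rw [← Finset.mul_sum]
        ring

/-- Domination of Fourier coefficients gives domination of `L²` norms. -/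
lemma integral_sq_le_of_norm_coef_le (hL : 0 < L) {f : (Fin n → ℝ) → ℝ}
    {g : Fin n → (Fin n → ℝ) → ℝ} (hf : SmoothPeriodic L f) (hg : ∀ i, SmoothPeriodic L (g i))
    {K : ℝ} (h : ∀ k, ‖coef L f k‖ ≤ K * ∑ i, ‖coef L (g i) k‖) :
    ∫ x in cube n L, f x ^ 2 ≤ K ^ 2 * n * ∑ i, ∫ x in cube n L, g i x ^ 2 := by
  have h1 := hasSum_sq_coef hL hf.contDiff.continuous hf.periodic
  have h2 := (hasSum_sum fun i (_ : i ∈ Finset.univ) =>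
    hasSum_sq_coef hL (hg i).contDiff.continuous (hg i).periodic).mul_left (K ^ 2 * n)
  have h3 := hasSum_le (fun k => ?_) h1 h2
  · rw [← Finset.mul_sum, mul_left_comm] at h3
    exact le_of_mul_le_mul_left h3 (by positivity)
  · calc ‖coef L f k‖ ^ 2 ≤ (K * ∑ i, ‖coef L (g i) k‖) ^ 2 :=
          pow_le_pow_left₀ (norm_nonneg _) (h k) 2
      _ = K ^ 2 * (∑ i, ‖coef L (g i) k‖) ^ 2 := mul_pow _ _ _
      _ ≤ K ^ 2 * (n * ∑ i, ‖coef L (g i) k‖ ^ 2) := by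
          refine mul_le_mul_of_nonneg_left ?_ (sq_nonneg K)
          simpa using sq_sum_le_card_mul_sum_sq (s := Finset.univ)
            (f := fun i => ‖coef L (g i) k‖)
      _ = _ := by ring

/-- The constant in the elliptic estimate for the Coulomb potential. -/
noncomputable def ellipticConst (L : ℝ) : ℝ := 1 + L / (2 * Real.pi)

lemma exists_norm_coef_pdPow_le (hL : 0 < L) (hA : ∀ i, SmoothPeriodic L (A i))
    (hB : ∀ i j, SmoothPeriodic L (B i j))
    (hcurl : ∀ i j x, pd i (A j) x - pd j (A i) x = B i j x)
    (hdiv : ∀ x, ∑ j, pd j (A j) x = 0) (hzero : ∀ i, coef L (A i) 0 = 0) {m : ℕ}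
    (μ : Fin n → ℕ) (hμ : ∑ i, μ i ≤ m + 1) :
    ∃ ν : Fin n → ℕ, ∑ i, ν i ≤ m ∧ ∀ j k, ‖coef L (pdPow μ (A j)) k‖ ≤
      ellipticConst L * ∑ i, ‖coef L (pdPow ν (B i j)) k‖ := by
  have hπ : 0 ≤ L / (2 * Real.pi) := by positivity
  by_cases hμ0 : μ = 0
  · subst hμ0
    refine ⟨0, by simp, fun j k => ?_⟩
    simp only [(isMultiplier_pdPow hL 0 _ (hA _)).2, (isMultiplier_pdPow hL 0 _ (hB _ _)).2]
    have h := mul_norm_coef_le hL hA hcurl hdiv hzero j k zero_le_one hπ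
      fun i => by rw [one_mul]; exact abs_freq_le_freqSq hL k i
    simp only [Pi.zero_apply, pow_zero, Finset.prod_const_one, one_mul] at h ⊢
    refine h.trans (mul_le_mul_of_nonneg_right ?_ (by positivity))
    unfold ellipticConst
    linarith
  · obtain ⟨l, hl⟩ := Function.ne_iff.1 hμ0
    obtain ⟨ν, rfl⟩ : ∃ ν : Fin n → ℕ, μ = ν + Pi.single l 1 := by
      refine ⟨μ - Pi.single l 1, ?_⟩
      refine (tsub_add_cancel_of_le fun i => ?_).symm
      by_cases hi : i = l
      · subst hi; simpa using Nat.one_le_iff_ne_zero.2 hl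
      · simp [hi]
    refine ⟨ν, ?_, fun j k => ?_⟩
    · simpa [Finset.sum_add_distrib] using hμ
    simp only [(isMultiplier_pdPow hL _ _ (hA _)).2, (isMultiplier_pdPow hL _ _ (hB _ _)).2,
      Pi.add_apply, pow_add, Finset.prod_mul_distrib, norm_mul, ← Finset.mul_sum]
    have h := mul_norm_coef_le hL hA hcurl hdiv hzero j k (abs_nonneg (freq L k l)) zero_le_one
      fun i => by
        have h1 := sq_freq_le_freqSq (L := L) k l
        have h2 := sq_freq_le_freqSq (L := L) k i
        rw [← sq_abs] at h1 h2
        nlinarith [sq_nonneg (|freq L k l| - |freq L k i|)]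
    have h3 : ‖∏ i, (Complex.I * (freq L k i : ℂ)) ^ (Pi.single l 1 : Fin n → ℕ) i‖ =
        |freq L k l| := by
      rw [Finset.prod_eq_single l (fun i _ hi => by simp [hi]) (by simp)]
      simp
    rw [h3, mul_assoc, mul_left_comm (ellipticConst L)]
    refine mul_le_mul_of_nonneg_left (h.trans ?_) (norm_nonneg (∏ i, _))
    refine mul_le_mul_of_nonneg_right ?_ (by positivity)
    unfold ellipticConst
    linarith

lemma integral_sq_pdPow_le_sobNorm_sq {m : ℕ} (f : (Fin n → ℝ) → ℝ) (ν : Fin n → ℕ)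
    (hν : ∑ i, ν i ≤ m) : ∫ x in cube n L, pdPow ν f x ^ 2 ≤ sobNorm n L m f ^ 2 := by
  have h0 : ∀ μ : Fin n → Fin (m + 1), 0 ≤ ∫ x in cube n L,
      pdPow (fun i => (μ i : ℕ)) f x ^ 2 := fun μ => integral_nonneg fun x => sq_nonneg _
  have hlt : ∀ i, ν i < m + 1 := fun i => Nat.lt_succ_of_le <|
    (Finset.single_le_sum (f := ν) (fun _ _ => Nat.zero_le _) (Finset.mem_univ i)).trans hν
  rw [sobNorm, Real.sq_sqrt (Finset.sum_nonneg fun μ _ => h0 μ)]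
  exact Finset.single_le_sum (f := fun μ : Fin n → Fin (m + 1) =>
      ∫ x in cube n L, pdPow (fun i => (μ i : ℕ)) f x ^ 2) (fun μ _ => h0 μ)
    (a := fun i => ⟨ν i, hlt i⟩) (by simpa using hν)

lemma sobNorm_nonneg {m : ℕ} (f : (Fin n → ℝ) → ℝ) : 0 ≤ sobNorm n L m f := Real.sqrt_nonneg _

/-- Elliptic regularity for the Coulomb potential, with a constant depending only on
`n`, `m` and `L`. -/
lemma sobNorm_succ_le (hL : 0 < L) (hA : ∀ i, SmoothPeriodic L (A i))
    (hB : ∀ i j, SmoothPeriodic L (B i j))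
    (hcurl : ∀ i j x, pd i (A j) x - pd j (A i) x = B i j x)
    (hdiv : ∀ x, ∑ j, pd j (A j) x = 0) (hzero : ∀ i, coef L (A i) 0 = 0) (m : ℕ) (j : Fin n) :
    sobNorm n L (m + 1) (A j) ≤
      √(Fintype.card (Fin n → Fin (m + 2)) * (ellipticConst L ^ 2 * n)) *
        ∑ i, sobNorm n L m (B i j) := by
  have hs : 0 ≤ ∑ i, sobNorm n L m (B i j) := Finset.sum_nonneg fun i _ => sobNorm_nonneg _
  rw [← Real.sqrt_sq hs, ← Real.sqrt_mul (by positivity), sobNorm]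
  refine Real.sqrt_le_sqrt ?_
  have hbound : ∀ μ ∈ Finset.univ.filter
      (fun μ : Fin n → Fin (m + 1 + 1) => (∑ i, (μ i : ℕ)) ≤ m + 1),
      ∫ x in cube n L, pdPow (fun i => (μ i : ℕ)) (A j) x ^ 2 ≤
        ellipticConst L ^ 2 * n * (∑ i, sobNorm n L m (B i j)) ^ 2 := by
    intro μ hμ
    obtain ⟨ν, hν, h⟩ := exists_norm_coef_pdPow_le hL hA hB hcurl hdiv hzero
      (fun i => (μ i : ℕ)) (Finset.mem_filter.1 hμ).2
    refine (integral_sq_le_of_norm_coef_le hL (isMultiplier_pdPow hL _ _ (hA j)).1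
      (fun i => (isMultiplier_pdPow hL ν _ (hB i j)).1) (h j)).trans ?_
    refine mul_le_mul_of_nonneg_left ?_ (by positivity)
    exact (Finset.sum_le_sum fun i _ => integral_sq_pdPow_le_sobNorm_sq _ ν hν).trans
      (Finset.sum_sq_le_sq_sum_of_nonneg fun i _ => sobNorm_nonneg _)
  refine (Finset.sum_le_card_nsmul _ _ _ hbound).trans ?_
  rw [nsmul_eq_mul, mul_assoc (Fintype.card _ : ℝ)]
  have hcard : ((Finset.univ.filter
      (fun μ : Fin n → Fin (m + 1 + 1) => (∑ i, (μ i : ℕ)) ≤ m + 1)).card : ℝ) ≤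
      Fintype.card (Fin n → Fin (m + 2)) := by
    exact_mod_cast Finset.card_le_univ _
  exact mul_le_mul_of_nonneg_right hcard (by positivity)

end Estimate

end TorusPotential

/-- Construction of a small vector potential on the torus: (i) every
closed `L`-periodic 2-form `B` supported (in the fundamental domain) in the unit ball
admits a smooth `L`-periodic potential `A` with `dA = B`; (ii) for every `ε > 0` there is
a `δ > 0`, depending only on `n`, `m`, `L` and `ε`, such that whenever
`Σ‖B_{ij}‖_{H^m} ≤ δ` the potential can be chosen with `Σ‖A_i‖_{H^{m+1}} ≤ ε`. -/
theorem stmt_15 (n m : ℕ) (hn : 3 ≤ n) (L : ℝ) (hL : 2 < L)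
    (hm : (n : ℝ) / 2 + 1 < m) :
    (∀ B : Fin n → Fin n → (Fin n → ℝ) → ℝ, GoodB n L B →
      ∃ A : Fin n → (Fin n → ℝ) → ℝ,
        (∀ i, ContDiff ℝ (⊤ : ℕ∞) (A i)) ∧
        (∀ i (x : Fin n → ℝ) (k : Fin n → ℤ),
          A i (x + fun l => L * (k l : ℝ)) = A i x) ∧
        (∀ i j (x : Fin n → ℝ), pd i (A j) x - pd j (A i) x = B i j x)) ∧
    (∀ ε : ℝ, 0 < ε → ∃ δ : ℝ, 0 < δ ∧
      ∀ B : Fin n → Fin n → (Fin n → ℝ) → ℝ, GoodB n L B →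
        (∑ i, ∑ j, sobNorm n L m (B i j)) ≤ δ →
        ∃ A : Fin n → (Fin n → ℝ) → ℝ,
          (∀ i, ContDiff ℝ (⊤ : ℕ∞) (A i)) ∧
          (∀ i (x : Fin n → ℝ) (k : Fin n → ℤ),
            A i (x + fun l => L * (k l : ℝ)) = A i x) ∧
          (∀ i j (x : Fin n → ℝ), pd i (A j) x - pd j (A i) x = B i j x) ∧
          (∑ i, sobNorm n L (m + 1) (A i)) ≤ ε) := by
  have hL0 : 0 < L := by linarith
  refine ⟨fun B hB => ?_, fun ε hε => ?_⟩
  · obtain ⟨A, hA, hcurl, -, -⟩ := hB.exists_potential hn hL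
    exact ⟨A, fun i => (hA i).contDiff, fun i => (hA i).periodic, hcurl⟩
  · obtain ⟨C, hC, hest⟩ : ∃ C : ℝ, 0 ≤ C ∧ ∀ A : Fin n → (Fin n → ℝ) → ℝ,
        ∀ B : Fin n → Fin n → (Fin n → ℝ) → ℝ, (∀ i, TorusPotential.SmoothPeriodic L (A i)) →
        (∀ i j, TorusPotential.SmoothPeriodic L (B i j)) →
        (∀ i j x, pd i (A j) x - pd j (A i) x = B i j x) → (∀ x, ∑ j, pd j (A j) x = 0) →
        (∀ i, TorusPotential.coef L (A i) 0 = 0) →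
        ∀ j, sobNorm n L (m + 1) (A j) ≤ C * ∑ i, sobNorm n L m (B i j) :=
      ⟨_, Real.sqrt_nonneg _, fun A B hA hB hcurl hdiv hzero j =>
        TorusPotential.sobNorm_succ_le hL0 hA hB hcurl hdiv hzero m j⟩
    refine ⟨ε / (C + 1), by positivity, fun B hB hδ => ?_⟩
    obtain ⟨A, hA, hcurl, hdiv, hzero⟩ := hB.exists_potential hn hL
    refine ⟨A, fun i => (hA i).contDiff, fun i => (hA i).periodic, hcurl, ?_⟩
    calc ∑ j, sobNorm n L (m + 1) (A j) ≤ ∑ j, C * ∑ i, sobNorm n L m (B i j) :=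
          Finset.sum_le_sum fun j _ => hest A B hA hB.smoothPeriodic hcurl hdiv hzero j
      _ = C * ∑ i, ∑ j, sobNorm n L m (B i j) := by rw [← Finset.mul_sum, Finset.sum_comm]
      _ ≤ C * (ε / (C + 1)) := mul_le_mul_of_nonneg_left hδ hC
      _ ≤ ε := by
          rw [mul_div_assoc', div_le_iff₀ (by positivity)]
          nlinarith
end
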